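/- The squared norm decomposes as (Θ_C^{(k)}, Θ_C^{(k)}) = c(𝔹ⁿ,k)·∫₀^{γ₀(0)}∫₀^{γ₀(0)} Σ_{h ∈ A_γ^{−1}ΓA_γ} K(hw,ξ)^k·J(h,w)^k·K(ξ,ξ)^{−k/2}·K(w,w)^{−k/2} φ(ξ) φ(w), where both line integrals are taken over the segment of C̃₀ from 0 to γ₀(0). -/

import Mathlib

open scoped BigOperators
open Complex MeasureTheory Filter Topology Matrix

namespace BallPaper

noncomputable section

variable {n : ℕ}

/-- The unit ball in ℂⁿ. -/
def ball (n : ℕ) : Set (Fin n → ℂ) := {z | ∑ i, ‖z i‖ ^ 2 < 1}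

/-- ⟨z,w⟩ = z₁ conj w₁ + ... + zₙ conj wₙ − 1. -/
def pair (z w : Fin n → ℂ) : ℂ := ∑ i, z i * star (w i) - 1

/-- The Hermitian form of signature (n,1) on ℂ^{n+1}:
⟨⟨u,v⟩⟩ = u₁ conj v₁ + ... + uₙ conj vₙ − u_{n+1} conj v_{n+1}. -/
def herm (u v : Fin (n + 1) → ℂ) : ℂ :=
  ∑ i : Fin n, u i.castSucc * star (v i.castSucc) - u (Fin.last n) * star (v (Fin.last n))

/-- SU(n,1): determinant-one matrices preserving the (n,1) Hermitian form. -/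
def SU (n : ℕ) : Set (Matrix (Fin (n + 1)) (Fin (n + 1)) ℂ) :=
  {A | A.det = 1 ∧ ∀ u v, herm (A.mulVec u) (A.mulVec v) = herm u v}

/-- The denominator a_{n+1,1} z₁ + ... + a_{n+1,n} zₙ + a_{n+1,n+1} of the
fractional-linear action. -/
def denom (A : Matrix (Fin (n + 1)) (Fin (n + 1)) ℂ) (z : Fin n → ℂ) : ℂ :=
  ∑ j : Fin n, A (Fin.last n) j.castSucc * z j + A (Fin.last n) (Fin.last n)

/-- The fractional-linear action of a matrix on ℂⁿ (defined on the ball). -/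
def act (A : Matrix (Fin (n + 1)) (Fin (n + 1)) ℂ) (z : Fin n → ℂ) : Fin n → ℂ :=
  fun j => (∑ l : Fin n, A j.castSucc l.castSucc * z l + A j.castSucc (Fin.last n)) / denom A z

/-- The complex Jacobian J(A,z) = (denominator)^{-(n+1)}. -/
def jac (A : Matrix (Fin (n + 1)) (Fin (n + 1)) ℂ) (z : Fin n → ℂ) : ℂ :=
  (denom A z)⁻¹ ^ (n + 1)

/-- The Bergman kernel K(z,w) = (n!/πⁿ) (−⟨z,w⟩)^{−(n+1)}. -/
def Kc (z w : Fin n → ℂ) : ℂ :=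
  (((Nat.factorial n : ℝ) / Real.pi ^ n : ℝ) : ℂ) * (-(pair z w))⁻¹ ^ (n + 1)

/-- K(z,z) as a real-valued function: K(z,z) = (n!/πⁿ) (1−|z|²)^{−(n+1)}. -/
def Kr (z : Fin n → ℂ) : ℝ :=
  (Nat.factorial n : ℝ) / Real.pi ^ n * ((1 - ∑ i, ‖z i‖ ^ 2)⁻¹) ^ (n + 1)

/-- c(𝔹ⁿ,k) = C((n+1)(k−1)+n, n). -/
def cB (n k : ℕ) : ℕ := Nat.choose ((n + 1) * (k - 1) + n) n

/-- The last index of Fin n. -/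
def lastI (n : ℕ) (hn : 0 < n) : Fin n := ⟨n - 1, by omega⟩

/-- The geodesic C̃₀ = {z ∈ 𝔹ⁿ : z₁ = ... = z_{n−1} = 0, zₙ ∈ (−1,1) real}. -/
def geo0 (n : ℕ) (hn : 0 < n) : Set (Fin n → ℂ) :=
  {z | (∀ i : Fin n, (i : ℕ) < n - 1 → z i = 0) ∧ (z (lastI n hn)).im = 0 ∧
    -1 < (z (lastI n hn)).re ∧ (z (lastI n hn)).re < 1}

/-- The point (0,...,0,x) of C̃₀. -/
def curve (n : ℕ) (hn : 0 < n) (x : ℝ) : Fin n → ℂ :=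
  fun i => if i = lastI n hn then (x : ℂ) else 0

/-- The vector (X,1) ∈ ℂ^{n+1}. -/
def snoc1 (X : Fin n → ℂ) : Fin (n + 1) → ℂ := Fin.snoc X 1

/-- The matrix A_γ, with columns v₁,...,v_{n−1},
⟨X,Y⟩⁻¹(X,1) + (1/2)(Y,1), ⟨X,Y⟩⁻¹(X,1) − (1/2)(Y,1). -/
def Amat (n : ℕ) (v : Fin (n - 1) → Fin (n + 1) → ℂ) (X Y : Fin n → ℂ) :
    Matrix (Fin (n + 1)) (Fin (n + 1)) ℂ :=
  Matrix.of fun i j =>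
    if h : (j : ℕ) < n - 1 then v ⟨j, h⟩ i
    else if (j : ℕ) = n - 1 then ((pair X Y)⁻¹ • snoc1 X + (2 : ℂ)⁻¹ • snoc1 Y) i
    else ((pair X Y)⁻¹ • snoc1 X - (2 : ℂ)⁻¹ • snoc1 Y) i

/-- σ = diag(1,...,1,−1). -/
def sigmaM (n : ℕ) : Matrix (Fin (n + 1)) (Fin (n + 1)) ℂ :=
  Matrix.diagonal fun i => if i = Fin.last n then -1 else 1

/-- Inverse hyperbolic cosine. -/
def arcosh (x : ℝ) : ℝ := Real.log (x + Real.sqrt (x ^ 2 - 1))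

/-- Inverse hyperbolic tangent. -/
def artanh (x : ℝ) : ℝ := Real.log ((1 + x) / (1 - x)) / 2

/-- The hyperbolic (Bergman) distance on the ball, determined by
cosh²(ρ(z,w)/2) = ⟨z,w⟩⟨w,z⟩/(⟨z,z⟩⟨w,w⟩). -/
def rho (z w : Fin n → ℂ) : ℝ :=
  2 * arcosh (Real.sqrt ((pair z w * pair w z).re / (pair z z * pair w w).re))

/-- A discrete subgroup Γ of SU(n,1) acting freely on the ball with compact quotient. -/
structure DiscreteGroup (n : ℕ) where
  Γ : Set (Matrix (Fin (n + 1)) (Fin (n + 1)) ℂ)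
  sub_SU : Γ ⊆ SU n
  one_mem : 1 ∈ Γ
  mul_mem : ∀ {A B}, A ∈ Γ → B ∈ Γ → A * B ∈ Γ
  inv_mem : ∀ {A}, A ∈ Γ → A⁻¹ ∈ Γ
  discrete : DiscreteTopology ↥Γ
  free : ∀ A ∈ Γ, (∃ z ∈ ball n, act A z = z) → A = 1
  cocompact : ∃ F : Set (Fin n → ℂ), F ⊆ ball n ∧ IsCompact F ∧
    ∀ z ∈ ball n, ∃ A ∈ Γ, act A z ∈ F

/-- A hyperbolic element γ of Γ, with real eigenvalues, real fixed points X, Y on the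
boundary, eigenvalue data λ, and the eigenvectors v₁,...,v_{n−1} for eigenvalues ±1,
orthonormal with respect to the form ⟨⟨.,.⟩⟩. -/
structure HypElt (n : ℕ) (G : DiscreteGroup n) where
  γ : Matrix (Fin (n + 1)) (Fin (n + 1)) ℂ
  mem : γ ∈ G.Γ
  ne_one : γ ≠ 1
  eig_real : ∀ μ ∈ spectrum ℂ γ, μ.im = 0
  X : Fin n → ℂ
  Y : Fin n → ℂ
  X_bd : ∑ i, ‖X i‖ ^ 2 = 1
  Y_bd : ∑ i, ‖Y i‖ ^ 2 = 1
  X_real : ∀ i, (X i).im = 0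
  Y_real : ∀ i, (Y i).im = 0
  lam : ℝ
  lam_sq : 1 < lam ^ 2
  eigX : γ.mulVec (snoc1 X) = (lam : ℂ) • snoc1 X
  eigY : γ.mulVec (snoc1 Y) = ((lam : ℂ))⁻¹ • snoc1 Y
  primitive : ∀ A ∈ G.Γ, ∀ m : ℕ, 2 ≤ m → A ^ m ≠ γ
  v : Fin (n - 1) → Fin (n + 1) → ℂ
  alph : Fin (n - 1) → ℂ
  alph_pm : ∀ j, alph j = 1 ∨ alph j = -1
  v_eig : ∀ j, γ.mulVec (v j) = alph j • v j
  v_on : ∀ j l, herm (v j) (v l) = if j = l then 1 else 0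

variable {G : DiscreteGroup n}

/-- The matrix A_γ associated to the hyperbolic element γ. -/
def HypElt.A (H : HypElt n G) : Matrix (Fin (n + 1)) (Fin (n + 1)) ℂ :=
  Amat n H.v H.X H.Y

/-- γ₀ = A_γ⁻¹ γ A_γ. -/
def HypElt.g0 (H : HypElt n G) : Matrix (Fin (n + 1)) (Fin (n + 1)) ℂ :=
  (H.A)⁻¹ * H.γ * H.A

/-- T = (λ²−1)/(λ²+1), the last coordinate of γ₀(0). -/
def HypElt.T (H : HypElt n G) : ℝ := (H.lam ^ 2 - 1) / (H.lam ^ 2 + 1)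

/-- The geodesic C̃ in 𝔹ⁿ with endpoints X, Y, as the image of C̃₀ under A_γ. -/
def HypElt.Ct (H : HypElt n G) (hn : 0 < n) : Set (Fin n → ℂ) :=
  act H.A '' geo0 n hn

/-- The length l(C) of the closed geodesic C, the hyperbolic distance from 0 to γ₀(0). -/
def HypElt.lenC (H : HypElt n G) : ℝ :=
  rho (0 : Fin n → ℂ) (act H.g0 (0 : Fin n → ℂ))

/-- A (measure-theoretic) fundamental domain for the action of Γ on the ball. -/
def IsFundDom (G : DiscreteGroup n) (F : Set (Fin n → ℂ)) : Prop :=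
  F ⊆ ball n ∧ MeasurableSet F ∧ (∀ z ∈ ball n, ∃ A ∈ G.Γ, act A z ∈ F) ∧
    ∀ A ∈ G.Γ, A ≠ 1 → volume {z ∈ F | act A z ∈ F} = 0

/-- The automorphy condition f(Az) J(A,z)^k = f(z). -/
def Automorphic (G : DiscreteGroup n) (k : ℕ) (f : (Fin n → ℂ) → ℂ) : Prop :=
  ∀ A ∈ G.Γ, ∀ z ∈ ball n, f (act A z) * jac A z ^ k = f z

/-- Membership in H̃⁰_Γ(k): holomorphic on the ball and automorphic of weight k. -/
def Htilde (G : DiscreteGroup n) (k : ℕ) (f : (Fin n → ℂ) → ℂ) : Prop :=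
  DifferentiableOn ℂ f (ball n) ∧ Automorphic G k f

/-- The inner product (f,g) = ∫_M f ḡ K(z,z)^{−k} dV = ∫_F f ḡ K(z,z)^{1−k} dV_e,
computed over a fundamental domain F. -/
def iprod (F : Set (Fin n → ℂ)) (k : ℕ) (f g : (Fin n → ℂ) → ℂ) : ℂ :=
  ∫ z in F, f z * star (g z) * ((Kr z ^ ((1 : ℤ) - (k : ℤ)) : ℝ) : ℂ)

/-- The Poincaré series Θ_w^{(k)}(z) = c(𝔹ⁿ,k) Σ_{A∈Γ} K(Az,w)^k J(A,z)^k. -/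
def ThetaPt (G : DiscreteGroup n) (k : ℕ) (w z : Fin n → ℂ) : ℂ :=
  (cB n k : ℂ) * ∑' A : ↥G.Γ, Kc (act (A : Matrix (Fin (n + 1)) (Fin (n + 1)) ℂ) z) w ^ k *
    jac (A : Matrix (Fin (n + 1)) (Fin (n + 1)) ℂ) z ^ k

/-- The relative Poincaré series
Θ_C^{(k)}(z) = ∫_C Θ_w^{(k)}(z) K(w,w)^{−k/2} ((A_γ⁻¹)*φ)(w), written out over one
period of C̃, parametrized by w = A_γ(0,...,0,x), x ∈ [0,T]. -/
def ThetaC (hn : 0 < n) (H : HypElt n G) (k : ℕ) (z : Fin n → ℂ) : ℂ :=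
  ∫ x in (0 : ℝ)..H.T, ThetaPt G k (act H.A (curve n hn x)) z *
    ((Kr (act H.A (curve n hn x)) ^ (-(k : ℝ) / 2) : ℝ) : ℂ) *
    ((Kr (curve n hn x) ^ (((n : ℝ) + 1))⁻¹ : ℝ) : ℂ)

/-- The set of integer powers of a matrix. -/
def zpows (g : Matrix (Fin (n + 1)) (Fin (n + 1)) ℂ) :
    Set (Matrix (Fin (n + 1)) (Fin (n + 1)) ℂ) := {h | ∃ m : ℤ, h = g ^ m}

/-- The conjugate group A_γ⁻¹ Γ A_γ. -/
def conjGrp (G : DiscreteGroup n) (H : HypElt n G) :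
    Set (Matrix (Fin (n + 1)) (Fin (n + 1)) ℂ) :=
  (fun g => (H.A)⁻¹ * g * H.A) '' G.Γ

end

end BallPaper

namespace BallPaper

noncomputable section

variable {n : ℕ}

section

/-- The unitary group of the form `herm`, with no condition on the determinant. -/
def PresHerm (A : Matrix (Fin (n + 1)) (Fin (n + 1)) ℂ) : Prop :=
  ∀ u v, herm (A.mulVec u) (A.mulVec v) = herm u v

/-- `1 - |z|²`. -/
def defect (z : Fin n → ℂ) : ℝ := 1 - ∑ i, ‖z i‖ ^ 2

lemma mem_ball_iff {z : Fin n → ℂ} : z ∈ ball n ↔ 0 < defect z := by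
  simp [ball, defect]

lemma pair_self (z : Fin n → ℂ) : pair z z = -(defect z : ℂ) := by
  simp only [pair, defect, Complex.star_def, Complex.mul_conj']
  push_cast
  ring

@[simp] lemma snoc1_castSucc (z : Fin n → ℂ) (i : Fin n) : snoc1 z i.castSucc = z i := by
  simp [snoc1]

@[simp] lemma snoc1_last (z : Fin n → ℂ) : snoc1 z (Fin.last n) = 1 := by
  simp [snoc1]

lemma herm_snoc1 (z w : Fin n → ℂ) : herm (snoc1 z) (snoc1 w) = pair z w := by
  simp [herm, pair]

lemma herm_smul_left (c : ℂ) (u v : Fin (n + 1) → ℂ) : herm (c • u) v = c * herm u v := by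
  simp only [herm, Pi.smul_apply, smul_eq_mul, mul_sub, Finset.mul_sum, mul_assoc]

lemma herm_smul_right (c : ℂ) (u v : Fin (n + 1) → ℂ) : herm u (c • v) = star c * herm u v := by
  simp only [herm, Pi.smul_apply, smul_eq_mul, mul_sub, Finset.mul_sum, star_mul']
  congr 1
  · exact Finset.sum_congr rfl fun i _ => by ring
  · ring

lemma herm_add_left (u u' v : Fin (n + 1) → ℂ) : herm (u + u') v = herm u v + herm u' v := by
  simp only [herm, Pi.add_apply, add_mul, Finset.sum_add_distrib]
  ring

lemma herm_add_right (u v v' : Fin (n + 1) → ℂ) : herm u (v + v') = herm u v + herm u v' := by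
  simp only [herm, Pi.add_apply, star_add, mul_add, Finset.sum_add_distrib]
  ring

lemma herm_conj (u v : Fin (n + 1) → ℂ) : star (herm u v) = herm v u := by
  simp only [herm, star_sub, star_sum, star_mul', star_star]
  congr 1
  · exact Finset.sum_congr rfl fun i _ => by ring
  · ring

lemma mulVec_snoc1_last_eq (A : Matrix (Fin (n + 1)) (Fin (n + 1)) ℂ) (z : Fin n → ℂ) :
    A.mulVec (snoc1 z) (Fin.last n) = denom A z := by
  simp [Matrix.mulVec, dotProduct, Fin.sum_univ_castSucc, denom]

lemma mulVec_snoc1_castSucc (A : Matrix (Fin (n + 1)) (Fin (n + 1)) ℂ) (z : Fin n → ℂ)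
    (j : Fin n) :
    A.mulVec (snoc1 z) j.castSucc =
      ∑ l : Fin n, A j.castSucc l.castSucc * z l + A j.castSucc (Fin.last n) := by
  simp [Matrix.mulVec, dotProduct, Fin.sum_univ_castSucc]

lemma act_apply (A : Matrix (Fin (n + 1)) (Fin (n + 1)) ℂ) (z : Fin n → ℂ) (j : Fin n) :
    act A z j = A.mulVec (snoc1 z) j.castSucc / denom A z := by
  rw [mulVec_snoc1_castSucc]; rfl

lemma mulVec_snoc1 (A : Matrix (Fin (n + 1)) (Fin (n + 1)) ℂ) (z : Fin n → ℂ)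
    (h : denom A z ≠ 0) : A.mulVec (snoc1 z) = denom A z • snoc1 (act A z) := by
  funext i
  refine Fin.lastCases ?_ (fun j => ?_) i
  · simp [mulVec_snoc1_last_eq]
  · simp only [Pi.smul_apply, snoc1_castSucc, act_apply, smul_eq_mul]
    field_simp

lemma act_eq_of_mulVec {A : Matrix (Fin (n + 1)) (Fin (n + 1)) ℂ} {z w : Fin n → ℂ} {c : ℂ}
    (hc : c ≠ 0) (h : A.mulVec (snoc1 z) = c • snoc1 w) : denom A z = c ∧ act A z = w := by
  have h1 : denom A z = c := by rw [← mulVec_snoc1_last_eq, h]; simp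
  refine ⟨h1, ?_⟩
  funext j
  rw [act_apply, h1, h]
  simp [hc]

lemma herm_self_re (u : Fin (n + 1) → ℂ) :
    herm u u = ((∑ i : Fin n, ‖u i.castSucc‖ ^ 2 - ‖u (Fin.last n)‖ ^ 2 : ℝ) : ℂ) := by
  simp only [herm, Complex.star_def, Complex.mul_conj']
  push_cast
  ring

namespace PresHerm

variable {A B : Matrix (Fin (n + 1)) (Fin (n + 1)) ℂ} (hA : PresHerm A) (hB : PresHerm B)
include hA

lemma denom_ne_zero {z : Fin n → ℂ} (hz : z ∈ ball n) : denom A z ≠ 0 := by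
  intro h
  have h1 := hA (snoc1 z) (snoc1 z)
  rw [herm_snoc1, pair_self, herm_self_re, mulVec_snoc1_last_eq, h, ← Complex.ofReal_neg,
    Complex.ofReal_inj] at h1
  have h2 := mem_ball_iff.1 hz
  have h3 : 0 ≤ ∑ i : Fin n, ‖A.mulVec (snoc1 z) i.castSucc‖ ^ 2 := by positivity
  simp at h1
  linarith

lemma pair_act {z w : Fin n → ℂ} (hz : z ∈ ball n) (hw : w ∈ ball n) :
    denom A z * star (denom A w) * pair (act A z) (act A w) = pair z w := by
  rw [← herm_snoc1, ← herm_snoc1 z w, ← hA (snoc1 z), mulVec_snoc1 A z (hA.denom_ne_zero hz),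
    mulVec_snoc1 A w (hA.denom_ne_zero hw), herm_smul_left, herm_smul_right, mul_assoc]

lemma defect_act {z : Fin n → ℂ} (hz : z ∈ ball n) :
    ‖denom A z‖ ^ 2 * defect (act A z) = defect z := by
  have h := hA.pair_act hz hz
  rw [pair_self, pair_self, Complex.star_def, Complex.mul_conj', ] at h
  have h2 : ((‖denom A z‖ ^ 2 * defect (act A z) : ℝ) : ℂ) = (defect z : ℂ) := by
    push_cast; linear_combination -h
  exact_mod_cast h2

lemma act_mem {z : Fin n → ℂ} (hz : z ∈ ball n) : act A z ∈ ball n := by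
  rw [mem_ball_iff] at *
  have h := hA.defect_act (mem_ball_iff.2 hz)
  have h2 : 0 < ‖denom A z‖ ^ 2 := by
    have := hA.denom_ne_zero (mem_ball_iff.2 hz)
    positivity
  by_contra h3
  nlinarith

include hB

lemma mul : PresHerm (A * B) := fun u v => by
  rw [← Matrix.mulVec_mulVec, ← Matrix.mulVec_mulVec, hA, hB]

lemma denom_act_mul {z : Fin n → ℂ} (hz : z ∈ ball n) :
    denom (A * B) z = denom A (act B z) * denom B z ∧ act (A * B) z = act A (act B z) := by
  apply act_eq_of_mulVec
    (mul_ne_zero (hA.denom_ne_zero (hB.act_mem hz)) (hB.denom_ne_zero hz))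
  rw [← Matrix.mulVec_mulVec, mulVec_snoc1 B z (hB.denom_ne_zero hz), Matrix.mulVec_smul,
    mulVec_snoc1 A _ (hA.denom_ne_zero (hB.act_mem hz)), smul_smul, mul_comm]

end PresHerm

@[simp] lemma denom_one (z : Fin n → ℂ) : denom 1 z = 1 := by
  rw [← mulVec_snoc1_last_eq]; simp

@[simp] lemma act_one (z : Fin n → ℂ) : act 1 z = z := by
  funext j
  rw [act_apply]; simp

lemma herm_eq_dotProduct (u v : Fin (n + 1) → ℂ) :
    herm u v = u ⬝ᵥ (sigmaM n *ᵥ star v) := by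
  simp only [sigmaM, dotProduct, Matrix.mulVec_diagonal, Fin.sum_univ_castSucc, herm]
  simp [Fin.ne_of_lt (Fin.castSucc_lt_last _)]
  ring

lemma PresHerm.transpose_mul {A : Matrix (Fin (n + 1)) (Fin (n + 1)) ℂ} (hA : PresHerm A) :
    Aᵀ * sigmaM n * A.map star = sigmaM n := by
  have key : ∀ M : Matrix (Fin (n + 1)) (Fin (n + 1)) ℂ, ∀ i j,
      (Mᵀ * sigmaM n * M.map star) i j = herm (M *ᵥ Pi.single i 1) (M *ᵥ Pi.single j 1) := by
    intro M i j
    rw [herm_eq_dotProduct, Matrix.mul_assoc, Matrix.mul_apply]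
    simp only [Matrix.mulVec_single_one, dotProduct, Matrix.transpose_apply]
    rfl
  ext i j
  rw [key, hA, ← Matrix.one_mulVec (Pi.single i 1), ← Matrix.one_mulVec (Pi.single j 1), ← key]
  simp

lemma det_sigmaM_sq : (sigmaM n).det * (sigmaM n).det = 1 := by
  rw [← Matrix.det_mul, sigmaM, Matrix.diagonal_mul_diagonal, Matrix.det_diagonal]
  refine Finset.prod_eq_one fun i _ => ?_
  split_ifs <;> simp

namespace PresHerm

variable {A : Matrix (Fin (n + 1)) (Fin (n + 1)) ℂ} (hA : PresHerm A)
include hA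

lemma norm_det : ‖A.det‖ = 1 := by
  have h := congrArg Matrix.det hA.transpose_mul
  have h0 : (sigmaM n).det ≠ 0 := fun h0 => by simpa [h0] using det_sigmaM_sq (n := n)
  have h1 : (A.map star).det = star A.det := by
    have := Matrix.det_conjTranspose A
    rwa [Matrix.conjTranspose, Matrix.transpose_map, Matrix.det_transpose] at this
  rw [Matrix.det_mul, Matrix.det_mul, Matrix.det_transpose, h1] at h
  have h2 : A.det * star A.det = 1 := by
    apply mul_right_cancel₀ h0
    linear_combination h
  rw [Complex.star_def, Complex.mul_conj'] at h2
  have h3 : ‖A.det‖ ^ 2 = 1 := by exact_mod_cast h2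
  exact (pow_eq_one_iff_of_nonneg (norm_nonneg _) two_ne_zero).1 h3

lemma isUnit_det : IsUnit A.det := by
  rw [isUnit_iff_ne_zero, ← norm_ne_zero_iff, hA.norm_det]
  exact one_ne_zero

lemma inv : PresHerm A⁻¹ := fun u v => by
  rw [← hA, Matrix.mulVec_mulVec, Matrix.mulVec_mulVec, Matrix.mul_nonsing_inv _ hA.isUnit_det]
  simp

lemma act_inv_act {z : Fin n → ℂ} (hz : z ∈ ball n) : act A⁻¹ (act A z) = z := by
  rw [← (hA.inv.denom_act_mul hA hz).2, Matrix.nonsing_inv_mul _ hA.isUnit_det, act_one]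

lemma act_act_inv {z : Fin n → ℂ} (hz : z ∈ ball n) : act A (act A⁻¹ z) = z := by
  rw [← (hA.denom_act_mul hA.inv hz).2, Matrix.mul_nonsing_inv _ hA.isUnit_det, act_one]

lemma injOn : Set.InjOn (act A) (ball n) := fun z hz w hw h => by
  rw [← hA.act_inv_act hz, h, hA.act_inv_act hw]

end PresHerm

end

section

/-- The complex Jacobian matrix of `act A` at `z`. -/
def actDeriv (A : Matrix (Fin (n + 1)) (Fin (n + 1)) ℂ) (z : Fin n → ℂ) :
    Matrix (Fin n) (Fin n) ℂ :=
  Matrix.of fun j l =>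
    (A j.castSucc l.castSucc - act A z j * A (Fin.last n) l.castSucc) / denom A z

lemma hasFDerivAt_denom (A : Matrix (Fin (n + 1)) (Fin (n + 1)) ℂ) (z : Fin n → ℂ) :
    HasFDerivAt (denom A)
      (∑ j : Fin n, A (Fin.last n) j.castSucc •
        ContinuousLinearMap.proj (R := ℂ) (φ := fun _ : Fin n => ℂ) j) z := by
  unfold denom
  refine HasFDerivAt.add_const _ (HasFDerivAt.fun_sum fun j _ => ?_)
  exact (hasFDerivAt_apply j z).const_mul _

lemma hasFDerivAt_act (A : Matrix (Fin (n + 1)) (Fin (n + 1)) ℂ) (z : Fin n → ℂ)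
    (h : denom A z ≠ 0) :
    HasFDerivAt (act A) (LinearMap.toContinuousLinearMap (Matrix.toLin' (actDeriv A z))) z := by
  rw [hasFDerivAt_pi']
  intro j
  have h1 : HasFDerivAt
      (fun z : Fin n → ℂ => ∑ l : Fin n, A j.castSucc l.castSucc * z l + A j.castSucc (Fin.last n))
      (∑ l : Fin n, A j.castSucc l.castSucc • ContinuousLinearMap.proj (R := ℂ) l) z :=
    HasFDerivAt.add_const _ (HasFDerivAt.fun_sum fun l _ => (hasFDerivAt_apply l z).const_mul _)
  have h2 := h1.mul ((hasDerivAt_inv h).comp_hasFDerivAt z (hasFDerivAt_denom A z))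
  refine (h2.congr_fderiv ?_).congr_of_eventuallyEq (.of_forall fun w => ?_)
  · ext v
    simp only [_root_.add_apply, _root_.smul_apply,
      _root_.sum_apply, ContinuousLinearMap.proj_apply, smul_eq_mul,
      ContinuousLinearMap.comp_apply, LinearMap.coe_toContinuousLinearMap', Matrix.toLin'_apply,
      Matrix.mulVec, dotProduct, actDeriv, Matrix.of_apply, act]
    rw [Finset.mul_sum, Finset.mul_sum, Finset.mul_sum, ← Finset.sum_add_distrib]
    refine Finset.sum_congr rfl fun l _ => ?_
    simp only [Function.comp_apply]
    field_simp
    ring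
  · simp [act, div_eq_mul_inv]

lemma det_actDeriv (A : Matrix (Fin (n + 1)) (Fin (n + 1)) ℂ) (z : Fin n → ℂ)
    (h : denom A z ≠ 0) : denom A z ^ (n + 1) * (actDeriv A z).det = A.det := by
  let e : Fin n ⊕ Fin 1 ≃ Fin (n + 1) := finSumFinEquiv
  have e1 : ∀ i : Fin n, e (Sum.inl i) = i.castSucc := fun i => rfl
  have e2 : ∀ i : Fin 1, e (Sum.inr i) = Fin.last n := fun i => by
    rw [Subsingleton.elim i 0]; rfl
  let P : Matrix (Fin n) (Fin n) ℂ := .of fun i j => A i.castSucc j.castSucc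
  let b : Matrix (Fin n) (Fin 1) ℂ := .of fun i _ => A i.castSucc (Fin.last n)
  let c : Matrix (Fin 1) (Fin n) ℂ := .of fun _ j => A (Fin.last n) j.castSucc
  let d : Matrix (Fin 1) (Fin 1) ℂ := .of fun _ _ => A (Fin.last n) (Fin.last n)
  have hA : A.submatrix e e = Matrix.fromBlocks P b c d := by
    ext i j
    rcases i with i | i <;> rcases j with j | j <;> simp [e1, e2, P, b, c, d]
  let Z : Matrix (Fin n) (Fin 1) ℂ := .of fun i _ => z i
  let a : Matrix (Fin n) (Fin 1) ℂ := .of fun i _ => act A z i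
  let d' : Matrix (Fin 1) (Fin 1) ℂ := .of fun _ _ => denom A z
  have key : Matrix.fromBlocks P b c d * Matrix.fromBlocks 1 Z 0 1 =
      Matrix.fromBlocks 1 a 0 1 * Matrix.fromBlocks (denom A z • actDeriv A z) 0 c d' := by
    rw [Matrix.fromBlocks_multiply, Matrix.fromBlocks_multiply, Matrix.fromBlocks_inj]
    refine ⟨?_, ?_, ?_, ?_⟩
    · ext i j
      simp [Matrix.mul_apply, P, a, c, actDeriv]
      field_simp
      ring
    · ext i j
      simp [Matrix.mul_apply, P, a, b, Z, d', act]
      field_simp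
    · simp
    · ext i j
      simp [Matrix.mul_apply, c, d, Z, d', denom]
  have h2 := congrArg Matrix.det key
  rw [Matrix.det_mul, Matrix.det_mul, Matrix.det_fromBlocks_zero₂₁, Matrix.det_fromBlocks_zero₂₁,
    Matrix.det_fromBlocks_zero₁₂, ← hA, Matrix.det_submatrix_equiv_self, Matrix.det_smul] at h2
  simp [d'] at h2
  rw [h2]
  ring

lemma norm_jac (A : Matrix (Fin (n + 1)) (Fin (n + 1)) ℂ) (z : Fin n → ℂ) :
    ‖jac A z‖ = (‖denom A z‖⁻¹) ^ (n + 1) := by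
  simp [jac]

lemma measurableSet_ball : MeasurableSet (ball n) := by
  unfold ball
  exact measurableSet_lt (by fun_prop) measurable_const

lemma continuous_denom (A : Matrix (Fin (n + 1)) (Fin (n + 1)) ℂ) : Continuous (denom A) := by
  unfold denom
  fun_prop

lemma measurable_act (A : Matrix (Fin (n + 1)) (Fin (n + 1)) ℂ) : Measurable (act A) := by
  unfold act
  refine measurable_pi_lambda _ fun j => Measurable.div ?_ (continuous_denom A).measurable
  fun_prop

lemma measurable_jac (A : Matrix (Fin (n + 1)) (Fin (n + 1)) ℂ) : Measurable (jac A) := by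
  unfold jac
  exact ((continuous_denom A).measurable.inv).pow_const _

namespace PresHerm

variable {A : Matrix (Fin (n + 1)) (Fin (n + 1)) ℂ} (hA : PresHerm A)
include hA

lemma abs_det_deriv {z : Fin n → ℂ} (hz : z ∈ ball n) :
    |((LinearMap.toContinuousLinearMap (Matrix.toLin' (actDeriv A z))).restrictScalars ℝ).det| =
      ‖jac A z‖ ^ 2 := by
  have h : (((LinearMap.toContinuousLinearMap
      (Matrix.toLin' (actDeriv A z))).restrictScalars ℝ).det) = ‖(actDeriv A z).det‖ ^ 2 := by
    rw [ContinuousLinearMap.det]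
    have : (((LinearMap.toContinuousLinearMap
      (Matrix.toLin' (actDeriv A z))).restrictScalars ℝ : (Fin n → ℂ) →L[ℝ] (Fin n → ℂ)) :
        (Fin n → ℂ) →ₗ[ℝ] (Fin n → ℂ)) = (Matrix.toLin' (actDeriv A z)).restrictScalars ℝ := rfl
    rw [this, LinearMap.det_restrictScalars, LinearMap.det_toLin', Algebra.norm_complex_apply,
      Complex.normSq_eq_norm_sq]
  have h1 := det_actDeriv A z (hA.denom_ne_zero hz)
  have h2 : ‖(actDeriv A z).det‖ = ‖jac A z‖ := by
    have h3 := congrArg norm h1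
    rw [norm_mul, norm_pow, hA.norm_det] at h3
    rw [norm_jac, inv_pow]
    exact eq_inv_of_mul_eq_one_right h3
  rw [h, h2, abs_of_nonneg (by positivity)]

lemma lintegral_image {E : Set (Fin n → ℂ)} (hE : MeasurableSet E) (hEb : E ⊆ ball n)
    (g : (Fin n → ℂ) → ENNReal) :
    ∫⁻ x in act A '' E, g x = ∫⁻ x in E, ENNReal.ofReal (‖jac A x‖ ^ 2) * g (act A x) := by
  rw [lintegral_image_eq_lintegral_abs_det_fderiv_mul volume hE
    (fun x hx => ((hasFDerivAt_act A x (hA.denom_ne_zero (hEb hx))).restrictScalars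
      ℝ).hasFDerivWithinAt) (hA.injOn.mono hEb)]
  exact setLIntegral_congr_fun hE fun x hx => by simp only [hA.abs_det_deriv (hEb hx)]

lemma integral_image {E : Set (Fin n → ℂ)} (hE : MeasurableSet E) (hEb : E ⊆ ball n)
    (g : (Fin n → ℂ) → ℂ) :
    ∫ x in act A '' E, g x = ∫ x in E, ((‖jac A x‖ ^ 2 : ℝ) : ℂ) * g (act A x) := by
  rw [integral_image_eq_integral_abs_det_fderiv_smul volume hE
    (fun x hx => ((hasFDerivAt_act A x (hA.denom_ne_zero (hEb hx))).restrictScalars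
      ℝ).hasFDerivWithinAt) (hA.injOn.mono hEb)]
  exact setIntegral_congr_fun hE fun x hx => by
    simp only [hA.abs_det_deriv (hEb hx), Complex.real_smul]

lemma image_eq {E : Set (Fin n → ℂ)} (hEb : E ⊆ ball n) :
    act A '' E = ball n ∩ act A⁻¹ ⁻¹' E := by
  ext z
  constructor
  · rintro ⟨w, hw, rfl⟩
    exact ⟨hA.act_mem (hEb hw), by rwa [Set.mem_preimage, hA.act_inv_act (hEb hw)]⟩
  · rintro ⟨hz, hw⟩
    exact ⟨_, hw, hA.act_act_inv hz⟩

lemma measurableSet_image {E : Set (Fin n → ℂ)} (hE : MeasurableSet E) (hEb : E ⊆ ball n) :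
    MeasurableSet (act A '' E) := by
  rw [hA.image_eq hEb]
  exact measurableSet_ball.inter (measurable_act _ hE)

lemma image_ball : act A '' ball n = ball n := by
  rw [hA.image_eq le_rfl]
  exact Set.inter_eq_left.2 fun z hz => hA.inv.act_mem hz

lemma volume_image_eq_zero {E : Set (Fin n → ℂ)} (hE : MeasurableSet E) (hEb : E ⊆ ball n)
    (h : volume E = 0) : volume (act A '' E) = 0 := by
  rw [← setLIntegral_one, hA.lintegral_image hE hEb]
  exact setLIntegral_measure_zero _ _ h

end PresHerm

end

section

lemma integral_pow_mul_one_sub_sq_pow (m N : ℕ) :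
    ∫ r in (0 : ℝ)..1, r ^ (2 * m + 1) * (1 - r ^ 2) ^ N =
      (m.factorial * N.factorial : ℝ) / (2 * (m + N + 1).factorial) := by
  induction N generalizing m with
  | zero =>
    simp only [pow_zero, mul_one, integral_pow, Nat.factorial_zero, add_zero, Nat.factorial_succ]
    have := Nat.factorial_pos m
    push_cast
    field_simp
    norm_num
    ring
  | succ N ih =>
    have hd : ∀ r : ℝ, HasDerivAt (fun r : ℝ => r ^ (2 * m + 2) * (1 - r ^ 2) ^ (N + 1))
        ((2 * m + 2) * (r ^ (2 * m + 1) * (1 - r ^ 2) ^ (N + 1)) -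
          2 * (N + 1) * (r ^ (2 * (m + 1) + 1) * (1 - r ^ 2) ^ N)) r := by
      intro r
      have h := ((hasDerivAt_id r).pow (2 * m + 2)).mul
        ((((hasDerivAt_id r).pow 2).const_sub 1).pow (N + 1))
      convert! h using 1
      simp
      ring
    have hi := intervalIntegral.integral_eq_sub_of_hasDerivAt (a := 0) (b := 1)
      (fun r _ => hd r) (Continuous.intervalIntegrable (by fun_prop) _ _)
    rw [intervalIntegral.integral_sub (Continuous.intervalIntegrable (by fun_prop) _ _)
      (Continuous.intervalIntegrable (by fun_prop) _ _), intervalIntegral.integral_const_mul,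
      intervalIntegral.integral_const_mul, ih] at hi
    have e : m + 1 + N + 1 = m + (N + 1) + 1 := by ring
    rw [e] at hi
    simp only [Nat.factorial_succ m, Nat.factorial_succ N] at hi ⊢
    have hm : (0 : ℝ) < m + 1 := by positivity
    have hf : (0 : ℝ) < (m + (N + 1) + 1).factorial := by exact_mod_cast Nat.factorial_pos _
    generalize ((m + (N + 1) + 1).factorial : ℝ) = q at *
    push_cast at hi ⊢
    norm_num at hi
    field_simp at hi ⊢
    have hi2 := (mul_eq_zero.1 (hi.trans (mul_zero q))).resolve_left hm.ne'
    linarith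

lemma volume_ball_eq : volume (ball n) = ENNReal.ofReal (Real.pi ^ n / n.factorial) := by
  have h := Complex.volume_sum_rpow_lt_one (Fin n) (p := 2) (by norm_num)
  simp only [Real.rpow_two, Fintype.card_fin] at h
  rw [ball, h]
  congr 2
  · norm_num
  · rw [mul_div_cancel_left₀ _ (two_ne_zero), Real.Gamma_nat_eq_factorial]

lemma volume_ball_ne_top : volume (ball n) ≠ ⊤ := by
  rw [volume_ball_eq]; exact ENNReal.ofReal_ne_top

lemma integral_defect_pow (hn : 0 < n) (N : ℕ) :
    ∫ z in ball n, defect z ^ N = Real.pi ^ n * N.factorial / (n + N).factorial := by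
  let e : (Fin n → ℂ) ≃L[ℝ] EuclideanSpace ℂ (Fin n) :=
    (PiLp.continuousLinearEquiv 2 ℝ (fun _ : Fin n => ℂ)).symm
  let μ : Measure (EuclideanSpace ℂ (Fin n)) := Measure.map e volume
  have : μ.IsAddHaarMeasure := e.isAddHaarMeasure_map volume
  have hem : MeasurableEmbedding e := e.toHomeomorph.measurableEmbedding
  have hne : Nonempty (Fin n) := ⟨⟨0, hn⟩⟩
  have hnorm : ∀ z, ‖e z‖ ^ 2 = ∑ i, ‖z i‖ ^ 2 := fun z => by
    rw [EuclideanSpace.norm_sq_eq]; rfl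
  have hball : ∀ z, ‖e z‖ < 1 ↔ z ∈ ball n := fun z => by
    rw [ball, Set.mem_ofPred_eq, ← hnorm]
    exact (sq_lt_one_iff₀ (norm_nonneg _)).symm
  let f : ℝ → ℝ := (Set.Iio (1 : ℝ)).indicator fun r => (1 - r ^ 2) ^ N
  have h1 : ∫ z in ball n, defect z ^ N = ∫ x, f ‖x‖ ∂μ := by
    rw [hem.integral_map, ← integral_indicator measurableSet_ball]
    congr 1
    funext z
    by_cases hz : z ∈ ball n
    · have h : ‖e z‖ ∈ Set.Iio 1 := (hball z).2 hz
      simp only [f]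
      rw [Set.indicator_of_mem hz, Set.indicator_of_mem h, hnorm, defect]
    · have h : ‖e z‖ ∉ Set.Iio 1 := fun h => hz ((hball z).1 h)
      simp only [f]
      rw [Set.indicator_of_notMem hz, Set.indicator_of_notMem h]
  have hvol : μ.real (Metric.ball 0 1) = Real.pi ^ n / n.factorial := by
    rw [Measure.real, hem.map_apply]
    have : e ⁻¹' Metric.ball 0 1 = ball n := by
      ext z
      rw [Set.mem_preimage, mem_ball_zero_iff, hball]
    rw [this, volume_ball_eq, ENNReal.toReal_ofReal (by positivity)]
  have hdim : Module.finrank ℝ (EuclideanSpace ℂ (Fin n)) = 2 * n := by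
    rw [← e.toLinearEquiv.finrank_eq]
    simp [Module.finrank_pi_fintype, mul_comm]
  have hint : ∫ y in Set.Ioi (0 : ℝ), y ^ (2 * n - 1) • f y =
      ∫ r in (0 : ℝ)..1, r ^ (2 * (n - 1) + 1) * (1 - r ^ 2) ^ N := by
    rw [intervalIntegral.integral_of_le zero_le_one, integral_Ioc_eq_integral_Ioo,
      ← Set.Ioi_inter_Iio, ← setIntegral_indicator measurableSet_Iio]
    congr 1
    funext r
    rw [show 2 * n - 1 = 2 * (n - 1) + 1 by omega]
    simp only [f, Set.indicator_apply, smul_eq_mul]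
    split_ifs <;> simp
  rw [h1, integral_fun_norm_addHaar, hdim, hvol, hint, integral_pow_mul_one_sub_sq_pow]
  obtain ⟨m, rfl⟩ : ∃ m, n = m + 1 := ⟨n - 1, by omega⟩
  have e1 : m + 1 - 1 + N + 1 = m + 1 + N := by omega
  rw [e1]
  simp only [Nat.factorial_succ m, add_tsub_cancel_right, nsmul_eq_mul, smul_eq_mul]
  have := Nat.factorial_pos m
  push_cast
  field_simp

/-- The normalizing constant `n! / πⁿ` of the Bergman kernel. -/
def bergmanConst (n : ℕ) : ℝ := (Nat.factorial n : ℝ) / Real.pi ^ n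

lemma bergmanConst_pos : 0 < bergmanConst n := by
  unfold bergmanConst; positivity

lemma Kr_eq (z : Fin n → ℂ) : Kr z = bergmanConst n * (defect z)⁻¹ ^ (n + 1) := rfl

lemma Kr_pos {z : Fin n → ℂ} (hz : z ∈ ball n) : 0 < Kr z := by
  rw [Kr_eq]
  have := mem_ball_iff.1 hz
  have := bergmanConst_pos (n := n)
  positivity

lemma bergmanConst_le_Kr {z : Fin n → ℂ} (hz : z ∈ ball n) : bergmanConst n ≤ Kr z := by
  rw [Kr_eq]
  have h := mem_ball_iff.1 hz
  refine le_mul_of_one_le_right bergmanConst_pos.le (one_le_pow₀ ?_)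
  rw [one_le_inv₀ h]
  have : 0 ≤ ∑ i, ‖z i‖ ^ 2 := by positivity
  simp only [defect]
  linarith

lemma cB_mul_integral (hn : 0 < n) (k : ℕ) :
    (cB n k : ℝ) * bergmanConst n * ∫ z in ball n, defect z ^ ((n + 1) * (k - 1)) = 1 := by
  rw [integral_defect_pow hn, cB, bergmanConst]
  generalize (n + 1) * (k - 1) = N
  have h := Nat.add_choose_mul_factorial_mul_factorial N n
  have h' : ((N + n).choose n * N.factorial * n.factorial : ℝ) = (N + n).factorial := by
    exact_mod_cast h
  rw [add_comm n N, ← h']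
  have h0 : (0 : ℝ) < (N + n).choose n := by exact_mod_cast Nat.choose_pos (by omega)
  field_simp

namespace PresHerm

variable {A B : Matrix (Fin (n + 1)) (Fin (n + 1)) ℂ} (hA : PresHerm A) (hB : PresHerm B)
include hA

lemma jac_ne_zero {z : Fin n → ℂ} (hz : z ∈ ball n) : jac A z ≠ 0 :=
  pow_ne_zero _ (inv_ne_zero (hA.denom_ne_zero hz))

lemma Kr_act {z : Fin n → ℂ} (hz : z ∈ ball n) : Kr (act A z) * ‖jac A z‖ ^ 2 = Kr z := by
  have h := hA.denom_ne_zero hz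
  rw [Kr_eq, Kr_eq, ← hA.defect_act hz, norm_jac]
  have : ‖denom A z‖ ≠ 0 := norm_ne_zero_iff.2 h
  rw [mul_assoc, ← pow_mul, mul_comm (n + 1) 2, pow_mul, ← mul_pow, mul_inv, inv_pow, mul_comm]
  ring

lemma Kc_act {z w : Fin n → ℂ} (hz : z ∈ ball n) (hw : w ∈ ball n) :
    Kc (act A z) (act A w) * jac A z * star (jac A w) = Kc z w := by
  have h := hA.denom_ne_zero hz
  rw [Kc, Kc, ← hA.pair_act hz hw, jac, jac, star_pow, star_inv₀, mul_assoc, mul_assoc,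
    ← mul_pow, ← mul_pow, ← mul_neg, mul_inv, mul_inv]
  congr 2
  ring

include hB in
lemma jac_mul {z : Fin n → ℂ} (hz : z ∈ ball n) :
    jac (A * B) z = jac A (act B z) * jac B z := by
  rw [jac, (hA.denom_act_mul hB hz).1, mul_inv, mul_pow]; rfl

end PresHerm

end

section

/-- The rotation `diag(c, …, c, 1)`. -/
def rotMat (n : ℕ) (c : ℂ) : Matrix (Fin (n + 1)) (Fin (n + 1)) ℂ :=
  Matrix.diagonal fun i => if i = Fin.last n then 1 else c

lemma presHerm_rotMat {c : ℂ} (hc : ‖c‖ = 1) : PresHerm (rotMat n c) := by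
  intro u v
  have hc2 : c * star c = 1 := by
    rw [Complex.star_def, Complex.mul_conj', hc]; simp
  simp only [herm, rotMat, Matrix.mulVec_diagonal]
  simp only [Fin.ne_of_lt (Fin.castSucc_lt_last _), if_false, if_true, one_mul, star_mul']
  congr 1
  refine Finset.sum_congr rfl fun i _ => ?_
  linear_combination (u i.castSucc * star (v i.castSucc)) * hc2

lemma rotMat_act (c : ℂ) (z : Fin n → ℂ) : denom (rotMat n c) z = 1 ∧ act (rotMat n c) z = c • z := by
  refine act_eq_of_mulVec one_ne_zero ?_
  funext i
  rw [rotMat, Matrix.mulVec_diagonal]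
  refine Fin.lastCases ?_ (fun j => ?_) i
  · simp
  · simp [Fin.ne_of_lt (Fin.castSucc_lt_last _)]

lemma zero_mem_ball : (0 : Fin n → ℂ) ∈ ball n := by simp [ball]

lemma smul_mem_ball {c : ℂ} (hc : ‖c‖ ≤ 1) {z : Fin n → ℂ} (hz : z ∈ ball n) :
    c • z ∈ ball n := by
  have hz' : ∑ i, ‖z i‖ ^ 2 < 1 := hz
  refine lt_of_le_of_lt (Finset.sum_le_sum fun i _ => ?_) hz'
  rw [Pi.smul_apply, norm_smul]
  gcongr
  exact mul_le_of_le_one_left (norm_nonneg _) hc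

lemma defect_rot {c : ℂ} (hc : ‖c‖ = 1) (z : Fin n → ℂ) : defect (c • z) = defect z := by
  simp [defect, hc]

lemma continuous_defect : Continuous (defect : (Fin n → ℂ) → ℝ) := by
  unfold defect; fun_prop

lemma defect_le_one (z : Fin n → ℂ) : defect z ≤ 1 := by
  have : 0 ≤ ∑ i, ‖z i‖ ^ 2 := by positivity
  simp only [defect]; linarith

/-- Mean value property on the ball for radial weights. -/
lemma integral_mul_defect_pow {g : (Fin n → ℂ) → ℂ} (hg : DifferentiableOn ℂ g (ball n)) {C : ℝ}
    {N : ℕ} (hC : ∀ z ∈ ball n, ‖g z‖ * defect z ^ N ≤ C) :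
    ∫ z in ball n, g z * ((defect z ^ N : ℝ) : ℂ) =
      g 0 * ((∫ z in ball n, defect z ^ N : ℝ) : ℂ) := by
  have hrot : ∀ θ : ℝ, ∫ z in ball n, g (circleMap 0 1 θ • z) * ((defect z ^ N : ℝ) : ℂ) =
      ∫ z in ball n, g z * ((defect z ^ N : ℝ) : ℂ) := by
    intro θ
    have hc : ‖circleMap 0 1 θ‖ = 1 := by simp
    have h := (presHerm_rotMat (n := n) hc).integral_image measurableSet_ball le_rfl
      (fun z => g z * ((defect z ^ N : ℝ) : ℂ))
    rw [(presHerm_rotMat hc).image_ball] at h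
    rw [h]
    refine integral_congr_ae (.of_forall fun z => ?_)
    simp only [(rotMat_act _ z).2, jac, (rotMat_act _ z).1, defect_rot hc]
    simp
  have hmean : ∀ z ∈ ball n, ∫ θ in (0 : ℝ)..2 * Real.pi, g (circleMap 0 1 θ • z) =
      2 * Real.pi * g 0 := by
    intro z hz
    have hd : DiffContOnCl ℂ (fun t : ℂ => g (t • z)) (Metric.ball 0 |1|) := by
      apply DifferentiableOn.diffContOnCl
      rw [abs_one, closure_ball _ one_ne_zero]
      refine hg.comp (by fun_prop) fun t ht => smul_mem_ball ?_ hz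
      simpa using ht
    have h := hd.circleAverage
    rw [Real.circleAverage_def, inv_smul_eq_iff₀ (by positivity)] at h
    rw [h]
    simp
  have hint : Integrable (Function.uncurry fun (θ : ℝ) (z : Fin n → ℂ) =>
      g (circleMap 0 1 θ • z) * ((defect z ^ N : ℝ) : ℂ))
      ((volume.restrict (Set.Ioc 0 (2 * Real.pi))).prod (volume.restrict (ball n))) := by
    have : IsFiniteMeasure (volume.restrict (ball n)) :=
      isFiniteMeasure_restrict.2 volume_ball_ne_top
    refine Integrable.of_bound (C := C) ?_ ?_
    · rw [Measure.prod_restrict]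
      refine ContinuousOn.aestronglyMeasurable ?_ (measurableSet_Ioc.prod measurableSet_ball)
      refine ContinuousOn.mul ?_ (Complex.continuous_ofReal.comp
        ((continuous_defect.comp continuous_snd).pow N)).continuousOn
      refine hg.continuousOn.comp (Continuous.continuousOn ?_) fun p hp => smul_mem_ball ?_ hp.2
      · exact ((continuous_circleMap 0 1).comp continuous_fst).smul continuous_snd
      · simp
    · rw [Measure.prod_restrict]
      refine (ae_restrict_iff' (measurableSet_Ioc.prod measurableSet_ball)).2
        (.of_forall fun p hp => ?_)
      have hc : ‖circleMap 0 1 p.1‖ = 1 := by simp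
      have h0 := (mem_ball_iff.1 hp.2).le
      simp only [Function.uncurry]
      rw [norm_mul, Complex.norm_real, Real.norm_of_nonneg (pow_nonneg h0 _), ← defect_rot hc]
      exact hC _ (smul_mem_ball hc.le hp.2)
  have hswap := integral_integral_swap hint
  rw [← intervalIntegral.integral_of_le (by positivity)] at hswap
  simp only [hrot] at hswap
  rw [intervalIntegral.integral_const] at hswap
  have hr : ∫ z in ball n, ∫ θ in Set.Ioc 0 (2 * Real.pi),
      g (circleMap 0 1 θ • z) * ((defect z ^ N : ℝ) : ℂ) =
      ∫ z in ball n, (2 * Real.pi * g 0) * ((defect z ^ N : ℝ) : ℂ) := by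
    refine setIntegral_congr_fun measurableSet_ball fun z hz => ?_
    rw [← intervalIntegral.integral_of_le (by positivity), intervalIntegral.integral_mul_const,
      hmean z hz]
  rw [hr, integral_const_mul, integral_complex_ofReal, Complex.real_smul] at hswap
  push_cast at hswap
  have hpi : (2 * Real.pi : ℂ) ≠ 0 := by
    exact_mod_cast (by positivity : (2 * Real.pi : ℝ) ≠ 0)
  refine mul_left_cancel₀ hpi ?_
  push_cast
  linear_combination hswap

lemma Kr_zpow {k : ℕ} (hk : 1 ≤ k) (z : Fin n → ℂ) :
    Kr z ^ ((1 : ℤ) - (k : ℤ)) = (Kr z ^ (k - 1))⁻¹ := by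
  rw [← zpow_natCast, ← _root_.zpow_neg]
  congr 1
  push_cast [hk]
  ring

lemma Kr_inv_pow (k : ℕ) (z : Fin n → ℂ) :
    (Kr z ^ (k - 1))⁻¹ = (bergmanConst n ^ (k - 1))⁻¹ * defect z ^ ((n + 1) * (k - 1)) := by
  rw [Kr_eq, mul_pow, mul_inv, ← pow_mul, inv_pow, inv_inv]

lemma sqrt_Kr_act {A : Matrix (Fin (n + 1)) (Fin (n + 1)) ℂ} (hA : PresHerm A) {z : Fin n → ℂ}
    (hz : z ∈ ball n) : √(Kr (act A z)) * ‖jac A z‖ = √(Kr z) := by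
  rw [← hA.Kr_act hz, Real.sqrt_mul (Kr_pos (hA.act_mem hz)).le, Real.sqrt_sq (norm_nonneg _)]

lemma sqrt_Kr_pow_mul_le {k : ℕ} (hk : 2 ≤ k) {z : Fin n → ℂ} (hz : z ∈ ball n) :
    √(Kr z) ^ k * (Kr z ^ (k - 1))⁻¹ ≤ (√(bergmanConst n) ^ (k - 2))⁻¹ := by
  obtain ⟨j, rfl⟩ : ∃ j, k = j + 2 := ⟨k - 2, by omega⟩
  have h0 : 0 < √(Kr z) := Real.sqrt_pos.2 (Kr_pos hz)
  have h1 : 0 < √(bergmanConst n) := Real.sqrt_pos.2 bergmanConst_pos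
  have h2 : √(bergmanConst n) ≤ √(Kr z) := Real.sqrt_le_sqrt (bergmanConst_le_Kr hz)
  have h3 : √(Kr z) ^ (j + 2) * (Kr z ^ (j + 2 - 1))⁻¹ = (√(Kr z) ^ j)⁻¹ := by
    rw [← Real.sq_sqrt (Kr_pos hz).le, Real.sqrt_sq h0.le, show j + 2 - 1 = j + 1 by omega]
    field_simp
    ring
  rw [h3, Nat.add_sub_cancel]
  gcongr

lemma Kc_zero_right (z : Fin n → ℂ) : Kc z 0 = (bergmanConst n : ℂ) := by
  simp [Kc, pair, bergmanConst]

lemma differentiableOn_act {A : Matrix (Fin (n + 1)) (Fin (n + 1)) ℂ} (hA : PresHerm A) :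
    DifferentiableOn ℂ (act A) (ball n) := fun z hz =>
  (hasFDerivAt_act A z (hA.denom_ne_zero hz)).differentiableAt.differentiableWithinAt

lemma differentiableOn_jac {A : Matrix (Fin (n + 1)) (Fin (n + 1)) ℂ} (hA : PresHerm A) :
    DifferentiableOn ℂ (jac A) (ball n) := fun z hz =>
  (((hasFDerivAt_denom A z).differentiableAt.inv
    (hA.denom_ne_zero hz)).pow _).differentiableWithinAt

/-- The weighted Bergman kernel reproduces holomorphic functions of controlled growth. -/
lemma reproducing (hn : 0 < n) {k : ℕ} (hk : 2 ≤ k) {f : (Fin n → ℂ) → ℂ}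
    (hf : DifferentiableOn ℂ f (ball n)) {M : ℝ} (hM : ∀ z ∈ ball n, ‖f z‖ ≤ M * √(Kr z) ^ k)
    {B : Matrix (Fin (n + 1)) (Fin (n + 1)) ℂ} (hB : PresHerm B) :
    (cB n k : ℂ) * ∫ z in ball n, f z * star (Kc z (act B 0) ^ k) *
      ((Kr z ^ ((1 : ℤ) - (k : ℤ)) : ℝ) : ℂ) = f (act B 0) := by
  have h0 := zero_mem_ball (n := n)
  have hκ := bergmanConst_pos (n := n)
  set N := (n + 1) * (k - 1) with hN
  let g : (Fin n → ℂ) → ℂ := fun z => f (act B z) * jac B z ^ k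
  have hg : DifferentiableOn ℂ g (ball n) :=
    (hf.comp (differentiableOn_act hB) fun z hz => hB.act_mem hz).mul
      ((differentiableOn_jac hB).pow k)
  have hM0 : 0 ≤ M := by
    have h1 := (norm_nonneg _).trans (hM 0 h0)
    have h2 : 0 < √(Kr (0 : Fin n → ℂ)) := Real.sqrt_pos.2 (Kr_pos h0)
    by_contra h3
    push Not at h3
    exact absurd h1 (not_le.2 (mul_neg_of_neg_of_pos h3 (pow_pos h2 k)))
  have hgM : ∀ z ∈ ball n, ‖g z‖ ≤ M * √(Kr z) ^ k := fun z hz => by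
    rw [← sqrt_Kr_act hB hz, mul_pow, ← mul_assoc]
    simp only [g, norm_mul, norm_pow]
    gcongr
    exact hM _ (hB.act_mem hz)
  have hmv := integral_mul_defect_pow hg (N := N)
    (C := M * (√(bergmanConst n) ^ (k - 2))⁻¹ * bergmanConst n ^ (k - 1)) fun z hz => by
      have h1 : defect z ^ N = (Kr z ^ (k - 1))⁻¹ * bergmanConst n ^ (k - 1) := by
        rw [Kr_inv_pow]
        field_simp
        rfl
      rw [h1, ← mul_assoc]
      refine mul_le_mul_of_nonneg_right ?_ (by positivity)
      have h2 : 0 ≤ (Kr z ^ (k - 1))⁻¹ := by have := Kr_pos hz; positivity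
      calc ‖g z‖ * (Kr z ^ (k - 1))⁻¹ ≤ M * √(Kr z) ^ k * (Kr z ^ (k - 1))⁻¹ :=
            mul_le_mul_of_nonneg_right (hgM z hz) h2
        _ ≤ _ := by
            rw [mul_assoc]
            exact mul_le_mul_of_nonneg_left (sqrt_Kr_pow_mul_le hk hz) hM0
  have hcov := hB.integral_image measurableSet_ball le_rfl
    (fun z => f z * star (Kc z (act B 0) ^ k) * ((Kr z ^ ((1 : ℤ) - (k : ℤ)) : ℝ) : ℂ))
  rw [hB.image_ball] at hcov
  have hJ0 := hB.jac_ne_zero h0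
  rw [hcov]
  have hpt : ∀ z ∈ ball n, ((‖jac B z‖ ^ 2 : ℝ) : ℂ) * (f (act B z) *
      star (Kc (act B z) (act B 0) ^ k) * ((Kr (act B z) ^ ((1 : ℤ) - (k : ℤ)) : ℝ) : ℂ)) =
      ((bergmanConst n : ℂ) * (jac B 0 ^ k)⁻¹) * (g z * ((defect z ^ N : ℝ) : ℂ)) := by
    intro z hz
    have hJ := hB.jac_ne_zero hz
    have hJs : star (jac B z) ≠ 0 := star_ne_zero.2 hJ
    have hKc := congrArg star (hB.Kc_act hz h0)
    rw [Kc_zero_right, star_mul', star_mul', star_star] at hKc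
    have hKc' : star (Kc (act B z) (act B 0)) =
        (bergmanConst n : ℂ) / (star (jac B z) * jac B 0) := by
      rw [eq_div_iff (mul_ne_zero hJs hJ0), ← mul_assoc, hKc]
      simp
    have hnJ : ‖jac B z‖ ≠ 0 := norm_ne_zero_iff.2 hJ
    have hKr : ((Kr (act B z) ^ (k - 1))⁻¹ : ℝ) = (Kr z ^ (k - 1))⁻¹ * (‖jac B z‖ ^ 2) ^ (k - 1) := by
      rw [← hB.Kr_act hz, mul_pow, mul_inv]
      field_simp
    have hnn : ((‖jac B z‖ ^ 2 : ℝ) : ℂ) = jac B z * star (jac B z) := by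
      rw [Complex.star_def, Complex.mul_conj']; push_cast; rfl
    rw [Kr_zpow (by omega), hKr, Kr_inv_pow, star_pow, hKc']
    rw [Complex.ofReal_mul, Complex.ofReal_mul, Complex.ofReal_pow (‖jac B z‖ ^ 2), hnn]
    obtain ⟨j, rfl⟩ : ∃ j, k = j + 1 := ⟨k - 1, by omega⟩
    simp only [Nat.add_sub_cancel, g] at *
    have hκ' : (bergmanConst n : ℂ) ≠ 0 := by exact_mod_cast hκ.ne'
    rw [hN]
    generalize star (jac B z) = s at *
    generalize jac B z = J at *
    push_cast
    rw [div_pow, mul_pow, mul_pow]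
    field_simp
    ring
  rw [setIntegral_congr_fun measurableSet_ball hpt, integral_const_mul, hmv]
  have hnorm : (cB n k : ℂ) * bergmanConst n * ((∫ z in ball n, defect z ^ N : ℝ) : ℂ) = 1 := by
    exact_mod_cast cB_mul_integral hn k
  simp only [g]
  field_simp
  linear_combination (f (act B 0)) * hnorm

end

section

lemma norm_sum_mul_sq_le (c z : Fin n → ℂ) :
    ‖∑ i, c i * z i‖ ^ 2 ≤ (∑ i, ‖c i‖ ^ 2) * ∑ i, ‖z i‖ ^ 2 := by
  have h1 : ‖∑ i, c i * z i‖ ≤ ∑ i, ‖c i‖ * ‖z i‖ :=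
    (norm_sum_le _ _).trans_eq (Finset.sum_congr rfl fun i _ => norm_mul _ _)
  calc _ ≤ (∑ i, ‖c i‖ * ‖z i‖) ^ 2 := by gcongr
    _ ≤ _ := Finset.sum_mul_sq_le_sq_mul_sq _ _ _

lemma sum_norm_sq_row_le {A : Matrix (Fin (n + 1)) (Fin (n + 1)) ℂ} (hA : PresHerm A) :
    ∑ j : Fin n, ‖A (Fin.last n) j.castSucc‖ ^ 2 ≤ ‖A (Fin.last n) (Fin.last n)‖ ^ 2 := by
  by_contra! h
  set S := ∑ j : Fin n, ‖A (Fin.last n) j.castSucc‖ ^ 2 with hS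
  set d := A (Fin.last n) (Fin.last n)
  have hS0 : 0 < S := lt_of_le_of_lt (by positivity) h
  have hS0' : (S : ℂ) ≠ 0 := by exact_mod_cast hS0.ne'
  let z : Fin n → ℂ := fun j => -(d / S) * star (A (Fin.last n) j.castSucc)
  have hz : z ∈ ball n := by
    change ∑ i, ‖z i‖ ^ 2 < 1
    have h1 : ∀ i, ‖z i‖ ^ 2 = (‖d‖ / S) ^ 2 * ‖A (Fin.last n) i.castSucc‖ ^ 2 := fun i => by
      simp only [z, norm_mul, norm_neg, norm_div, norm_star, mul_pow]
      rw [Complex.norm_of_nonneg hS0.le]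
    simp_rw [h1]
    rw [← Finset.mul_sum, ← hS, div_pow, div_mul_eq_mul_div, div_lt_one (by positivity), sq S]
    exact mul_lt_mul_of_pos_right h hS0
  refine hA.denom_ne_zero hz ?_
  have h2 : ∀ j : Fin n, A (Fin.last n) j.castSucc * z j =
      -(d / S) * ((‖A (Fin.last n) j.castSucc‖ ^ 2 : ℝ) : ℂ) := fun j => by
    simp only [z]
    rw [mul_left_comm, Complex.star_def, Complex.mul_conj']
    push_cast
    rfl
  rw [denom]
  simp_rw [h2]
  rw [← Finset.mul_sum, ← Complex.ofReal_sum, ← hS]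
  field_simp
  ring

lemma defect_half_le_of_sq_le {z : Fin n → ℂ} {x a : ℝ} (ha : 0 ≤ a) (hz : z ∈ ball n)
    (h : x ^ 2 ≤ a ^ 2 * (1 - defect z)) : x ≤ a * (1 - defect z / 2) := by
  have h0 := mem_ball_iff.1 hz
  have h1 := defect_le_one z
  refine abs_le_of_sq_le_sq' ?_ (by apply mul_nonneg ha; linarith) |>.2
  refine h.trans ?_
  rw [mul_pow]
  refine mul_le_mul_of_nonneg_left ?_ (by positivity)
  nlinarith

lemma norm_denom_sub_le {A : Matrix (Fin (n + 1)) (Fin (n + 1)) ℂ} (hA : PresHerm A)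
    {z : Fin n → ℂ} (hz : z ∈ ball n) :
    ‖denom A z - denom A 0‖ ≤ ‖denom A 0‖ * (1 - defect z / 2) := by
  refine defect_half_le_of_sq_le (norm_nonneg _) hz ?_
  have h0 : denom A 0 = A (Fin.last n) (Fin.last n) := by simp [denom]
  have h1 : denom A z - denom A 0 = ∑ j : Fin n, A (Fin.last n) j.castSucc * z j := by
    rw [h0, denom]; ring
  rw [h1, h0]
  refine (norm_sum_mul_sq_le _ _).trans ?_
  have : 1 - defect z = ∑ i, ‖z i‖ ^ 2 := by simp [defect]
  rw [this]
  exact mul_le_mul_of_nonneg_right (sum_norm_sq_row_le hA) (by positivity)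

lemma norm_jac_le {A : Matrix (Fin (n + 1)) (Fin (n + 1)) ℂ} (hA : PresHerm A)
    {z : Fin n → ℂ} (hz : z ∈ ball n) :
    ‖jac A z‖ ≤ (2 * (defect z)⁻¹) ^ (n + 1) * ‖jac A 0‖ := by
  have hd := mem_ball_iff.1 hz
  have h1 := norm_denom_sub_le hA hz
  have h2 : 0 < ‖denom A 0‖ := norm_pos_iff.2 (hA.denom_ne_zero zero_mem_ball)
  have h3 : 0 < ‖denom A z‖ := norm_pos_iff.2 (hA.denom_ne_zero hz)
  have h4 : ‖denom A 0‖ - ‖denom A z‖ ≤ ‖denom A z - denom A 0‖ := by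
    rw [norm_sub_rev]; exact norm_sub_norm_le _ _
  rw [norm_jac, norm_jac, ← mul_pow]
  gcongr
  rw [mul_assoc, ← mul_inv, ← div_eq_mul_inv, inv_le_comm₀ h3 (by positivity), inv_div,
    div_le_iff₀ two_pos]
  nlinarith

lemma norm_jac_zero_le {A : Matrix (Fin (n + 1)) (Fin (n + 1)) ℂ} (hA : PresHerm A)
    {z : Fin n → ℂ} (hz : z ∈ ball n) :
    ‖jac A 0‖ ≤ 2 ^ (n + 1) * ‖jac A z‖ := by
  have hd := mem_ball_iff.1 hz
  have h1 := norm_denom_sub_le hA hz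
  have h2 : 0 < ‖denom A 0‖ := norm_pos_iff.2 (hA.denom_ne_zero zero_mem_ball)
  have h3 : 0 < ‖denom A z‖ := norm_pos_iff.2 (hA.denom_ne_zero hz)
  have h4 : ‖denom A z‖ - ‖denom A 0‖ ≤ ‖denom A z - denom A 0‖ := norm_sub_norm_le _ _
  rw [norm_jac, norm_jac, ← mul_pow]
  gcongr
  rw [← div_eq_mul_inv, inv_le_comm₀ h2 (by positivity), inv_div, div_le_iff₀ two_pos]
  nlinarith

lemma defect_half_le_norm_pair {z w : Fin n → ℂ} (hz : z ∈ ball n) (hw : w ∈ ball n) :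
    defect w / 2 ≤ ‖pair z w‖ := by
  have h1 : ‖∑ i, z i * star (w i)‖ ≤ 1 * (1 - defect w / 2) := by
    refine defect_half_le_of_sq_le zero_le_one hw ?_
    refine (norm_sum_mul_sq_le _ _).trans ?_
    have : 1 - defect w = ∑ i, ‖star (w i)‖ ^ 2 := by simp [defect]
    rw [this]
    refine mul_le_mul_of_nonneg_right ?_ (by positivity)
    have := mem_ball_iff.1 hz
    rw [defect] at this
    linarith
  have h2 : ‖(1 : ℂ)‖ - ‖∑ i, z i * star (w i)‖ ≤ ‖1 - ∑ i, z i * star (w i)‖ :=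
    norm_sub_norm_le _ _
  rw [norm_one, norm_sub_rev] at h2
  rw [pair]
  linarith

lemma norm_Kc_le {z w : Fin n → ℂ} (hz : z ∈ ball n) (hw : w ∈ ball n) :
    ‖Kc z w‖ ≤ bergmanConst n * (2 * (defect w)⁻¹) ^ (n + 1) := by
  have hd := mem_ball_iff.1 hw
  have h := defect_half_le_norm_pair hz hw
  have hκ := bergmanConst_pos (n := n)
  have e : Kc z w = (bergmanConst n : ℂ) * (-(pair z w))⁻¹ ^ (n + 1) := rfl
  rw [e, norm_mul, Complex.norm_of_nonneg hκ.le, norm_pow, norm_inv, norm_neg]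
  gcongr
  rw [← div_eq_mul_inv, ← inv_div]
  gcongr

lemma Kr_continuousOn : ContinuousOn (Kr : (Fin n → ℂ) → ℝ) (ball n) := by
  have : ContinuousOn (fun z : Fin n → ℂ => bergmanConst n * (defect z)⁻¹ ^ (n + 1)) (ball n) :=
    continuousOn_const.mul ((continuous_defect.continuousOn.inv₀ fun z hz =>
      (mem_ball_iff.1 hz).ne').pow _)
  exact this

lemma measurable_Kr : Measurable (Kr : (Fin n → ℂ) → ℝ) := by
  have : Measurable (fun z : Fin n → ℂ => bergmanConst n * (defect z)⁻¹ ^ (n + 1)) :=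
    (continuous_defect.measurable.inv.pow_const _).const_mul _
  exact this

namespace DiscreteGroup

variable (G : DiscreteGroup n)

instance countable : Countable G.Γ := by
  have := G.discrete
  have : SecondCountableTopology (Matrix (Fin (n + 1)) (Fin (n + 1)) ℂ) :=
    inferInstanceAs (SecondCountableTopology (Fin (n + 1) → Fin (n + 1) → ℂ))
  exact countable_of_Lindelof_of_discrete

variable {G}

lemma presHerm {A : Matrix (Fin (n + 1)) (Fin (n + 1)) ℂ} (hA : A ∈ G.Γ) : PresHerm A :=
  (G.sub_SU hA).2

lemma mul_inv_cancel {A : Matrix (Fin (n + 1)) (Fin (n + 1)) ℂ} (hA : A ∈ G.Γ) : A * A⁻¹ = 1 :=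
  Matrix.mul_nonsing_inv _ (presHerm hA).isUnit_det

lemma inv_mul_cancel {A : Matrix (Fin (n + 1)) (Fin (n + 1)) ℂ} (hA : A ∈ G.Γ) : A⁻¹ * A = 1 :=
  Matrix.nonsing_inv_mul _ (presHerm hA).isUnit_det

/-- Right translation `A ↦ A * B` on the group. -/
def mulRightEquiv {B : Matrix (Fin (n + 1)) (Fin (n + 1)) ℂ} (hB : B ∈ G.Γ) : G.Γ ≃ G.Γ where
  toFun A := ⟨A.1 * B, G.mul_mem A.2 hB⟩
  invFun A := ⟨A.1 * B⁻¹, G.mul_mem A.2 (G.inv_mem hB)⟩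
  left_inv A := Subtype.ext (by simp [Matrix.mul_assoc, mul_inv_cancel hB])
  right_inv A := Subtype.ext (by simp [Matrix.mul_assoc, inv_mul_cancel hB])

end DiscreteGroup

open DiscreteGroup

namespace IsFundDom

variable {G : DiscreteGroup n} {F : Set (Fin n → ℂ)} (hF : IsFundDom G F)
include hF

lemma iUnion_image : ⋃ A : G.Γ, act A.1 '' F = ball n := by
  ext z
  simp only [Set.mem_iUnion]
  constructor
  · rintro ⟨A, w, hw, rfl⟩
    exact (presHerm A.2).act_mem (hF.1 hw)
  · intro hz
    obtain ⟨A, hA, h⟩ := hF.2.2.1 z hz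
    exact ⟨⟨A⁻¹, G.inv_mem hA⟩, act A z, h, (presHerm hA).act_inv_act hz⟩

lemma measurableSet_image (A : G.Γ) : MeasurableSet (act A.1 '' F) :=
  (presHerm A.2).measurableSet_image hF.2.1 hF.1

lemma aedisjoint : Pairwise (Function.onFun (AEDisjoint volume) fun A : G.Γ => act A.1 '' F) := by
  intro A B hAB
  have hA := presHerm A.2
  have hB := presHerm B.2
  have hne : B.1⁻¹ * A.1 ≠ 1 := fun h => hAB <| Subtype.ext <| by
    rw [← Matrix.one_mul A.1, ← mul_inv_cancel B.2, Matrix.mul_assoc, h, Matrix.mul_one]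
  have h0 := hF.2.2.2 _ (G.mul_mem (G.inv_mem B.2) A.2) hne
  have hm : MeasurableSet {z ∈ F | act (B.1⁻¹ * A.1) z ∈ F} :=
    hF.2.1.inter (measurable_act _ hF.2.1)
  refine measure_mono_null ?_ (hA.volume_image_eq_zero hm (fun z hz => hF.1 hz.1) h0)
  rintro _ ⟨⟨z, hz, rfl⟩, ⟨w, hw, h⟩⟩
  refine ⟨z, ⟨hz, ?_⟩, rfl⟩
  rw [(hB.inv.denom_act_mul hA (hF.1 hz)).2, ← h, hB.act_inv_act (hF.1 hw)]
  exact hw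

lemma lintegral_ball (g : (Fin n → ℂ) → ENNReal) :
    ∫⁻ z in ball n, g z =
      ∑' A : G.Γ, ∫⁻ z in F, ENNReal.ofReal (‖jac A.1 z‖ ^ 2) * g (act A.1 z) := by
  rw [← hF.iUnion_image, lintegral_iUnion₀ (fun A => (hF.measurableSet_image A).nullMeasurableSet)
    hF.aedisjoint]
  exact tsum_congr fun A => (presHerm A.2).lintegral_image hF.2.1 hF.1 g

lemma exists_summable : ∃ z ∈ ball n, Summable fun A : G.Γ => ‖jac A.1 z‖ ^ 2 := by
  have h1 := hF.lintegral_ball fun _ => 1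
  simp only [mul_one, lintegral_const, Measure.restrict_apply_univ, one_mul] at h1
  have hm : ∀ A : G.Γ, AEMeasurable (fun z => ENNReal.ofReal (‖jac A.1 z‖ ^ 2))
      (volume.restrict F) := fun A =>
    (((measurable_jac A.1).norm.pow_const 2).ennreal_ofReal).aemeasurable
  rw [← lintegral_tsum hm] at h1
  have hpos : volume (ball n) ≠ 0 := by
    rw [volume_ball_eq]
    have : 0 < Real.pi ^ n / n.factorial := by have := Real.pi_pos; positivity
    simpa using this
  have hF0 : (volume.restrict F) ≠ 0 := by
    intro h
    rw [h, lintegral_zero_measure] at h1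
    exact hpos h1
  have hae := ae_lt_top' (μ := volume.restrict F)
    (f := fun z => ∑' A : G.Γ, ENNReal.ofReal (‖jac A.1 z‖ ^ 2))
    (AEMeasurable.tsum hm)
    (h1 ▸ volume_ball_ne_top)
  have : NeBot (ae (volume.restrict F)) := ae_neBot.2 hF0
  obtain ⟨z, hz, hzF⟩ := (hae.and (ae_restrict_mem hF.2.1)).exists
  refine ⟨z, hF.1 hzF, ?_⟩
  have h2 := ENNReal.summable_toReal hz.ne
  refine h2.congr fun A => ?_
  rw [ENNReal.toReal_ofReal (by positivity)]

lemma lintegral_Kr_lt_top : ∫⁻ z in F, ENNReal.ofReal (Kr z) < ⊤ := by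
  obtain ⟨F0, hF0b, hF0c, hF0⟩ := G.cocompact
  have h1 := hF.lintegral_ball (F0.indicator fun z => ENNReal.ofReal (Kr z))
  have hm : ∀ A : G.Γ, Measurable fun z => ENNReal.ofReal (‖jac A.1 z‖ ^ 2) *
      F0.indicator (fun z => ENNReal.ofReal (Kr z)) (act A.1 z) := fun A =>
    (((measurable_jac A.1).norm.pow_const 2).ennreal_ofReal).mul
      ((measurable_Kr.ennreal_ofReal.indicator hF0c.measurableSet).comp (measurable_act _))
  rw [← lintegral_tsum fun A => (hm A).aemeasurable] at h1
  obtain ⟨R, hR⟩ := hF0c.exists_bound_of_continuousOn (Kr_continuousOn.mono hF0b)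
  have h2 : ∫⁻ z in ball n, F0.indicator (fun z => ENNReal.ofReal (Kr z)) z < ⊤ := by
    refine lt_of_le_of_lt (b := ∫⁻ z in ball n, ENNReal.ofReal R) (lintegral_mono fun z => ?_) ?_
    · by_cases hz : z ∈ F0
      · rw [Set.indicator_of_mem hz]
        exact ENNReal.ofReal_le_ofReal ((le_abs_self _).trans (hR z hz))
      · rw [Set.indicator_of_notMem hz]
        exact zero_le
    · rw [setLIntegral_const]
      exact ENNReal.mul_lt_top ENNReal.ofReal_lt_top volume_ball_ne_top.lt_top
  rw [h1] at h2
  refine lt_of_le_of_lt (setLIntegral_mono' hF.2.1 fun z hz => ?_) h2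
  obtain ⟨A, hA, h⟩ := hF0 z (hF.1 hz)
  refine le_trans ?_ (ENNReal.le_tsum ⟨A, hA⟩)
  rw [Set.indicator_of_mem h, ← ENNReal.ofReal_mul (by positivity), mul_comm,
    (presHerm hA).Kr_act (hF.1 hz)]

lemma integrable_Kr : IntegrableOn (fun z => Kr z) F := by
  refine ⟨measurable_Kr.aestronglyMeasurable, ?_⟩
  rw [hasFiniteIntegral_iff_norm]
  refine lt_of_le_of_lt (setLIntegral_mono' hF.2.1 fun z hz => ?_) hF.lintegral_Kr_lt_top
  rw [Real.norm_of_nonneg (Kr_pos (hF.1 hz)).le]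

lemma summable_jac_zero {k : ℕ} (hk : 2 ≤ k) : Summable fun A : G.Γ => ‖jac A.1 0‖ ^ k := by
  obtain ⟨z, hz, hs⟩ := hF.exists_summable
  have h2 : Summable fun A : G.Γ => ‖jac A.1 0‖ ^ 2 := by
    refine Summable.of_nonneg_of_le (fun A => by positivity) (fun A => ?_)
      (hs.mul_left ((2 ^ (n + 1)) ^ 2))
    rw [← mul_pow]
    have := norm_jac_zero_le (presHerm A.2) hz
    gcongr
  refine Summable.of_norm_bounded_eventually h2 ?_
  have h3 := h2.tendsto_cofinite_zero.eventually (gt_mem_nhds zero_lt_one)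
  filter_upwards [h3] with A hA
  rw [Real.norm_of_nonneg (by positivity)]
  have h4 : ‖jac A.1 0‖ ≤ 1 := by
    by_contra! h
    nlinarith
  exact pow_le_pow_of_le_one (norm_nonneg _) h4 hk

lemma summable_jac {k : ℕ} (hk : 2 ≤ k) {z : Fin n → ℂ} (hz : z ∈ ball n) :
    Summable fun A : G.Γ => ‖jac A.1 z‖ ^ k := by
  refine Summable.of_nonneg_of_le (fun A => by positivity) (fun A => ?_)
    ((hF.summable_jac_zero hk).mul_left (((2 * (defect z)⁻¹) ^ (n + 1)) ^ k))
  rw [← mul_pow]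
  have := norm_jac_le (presHerm A.2) hz
  gcongr

lemma exists_tsum_jac_le {k : ℕ} (hk : 2 ≤ k) :
    ∃ M : ℝ, 0 ≤ M ∧ ∀ z ∈ ball n, ∑' A : G.Γ, ‖jac A.1 z‖ ^ k ≤ M * √(Kr z) ^ k := by
  obtain ⟨F0, hF0b, hF0c, hF0⟩ := G.cocompact
  obtain ⟨R, hR⟩ := hF0c.exists_bound_of_continuousOn
    (f := fun z => (2 * (defect z)⁻¹) ^ (n + 1)) ((continuousOn_const.mul
    ((continuous_defect.continuousOn.inv₀ fun z hz => (mem_ball_iff.1 hz).ne').mono hF0b)).pow _)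
  set S := ∑' A : G.Γ, ‖jac A.1 0‖ ^ k
  have hκ := bergmanConst_pos (n := n)
  have hS : 0 ≤ S := tsum_nonneg fun A => by positivity
  have h0 : 0 ≤ R := by
    obtain ⟨A, hA, h⟩ := hF0 0 zero_mem_ball
    exact (norm_nonneg _).trans (hR _ h)
  refine ⟨R ^ k * S * (√(bergmanConst n) ^ k)⁻¹, by positivity, fun z hz => ?_⟩
  obtain ⟨B, hB, h⟩ := hF0 z hz
  have hBz := (presHerm hB).act_mem hz
  have h1 : ∑' A : G.Γ, ‖jac A.1 z‖ ^ k =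
      (∑' A : G.Γ, ‖jac A.1 (act B z)‖ ^ k) * ‖jac B z‖ ^ k := by
    rw [← (mulRightEquiv hB).tsum_eq, ← tsum_mul_right]
    refine tsum_congr fun A => ?_
    change ‖jac (A.1 * B) z‖ ^ k = _
    rw [(presHerm A.2).jac_mul (presHerm hB) hz, norm_mul, mul_pow]
  have h2 : ∑' A : G.Γ, ‖jac A.1 (act B z)‖ ^ k ≤ R ^ k * S := by
    rw [← tsum_mul_left]
    refine (hF.summable_jac hk hBz).tsum_le_tsum (fun A => ?_)
      ((hF.summable_jac_zero hk).mul_left _)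
    rw [← mul_pow]
    have h3 := norm_jac_le (presHerm A.2) hBz
    have h4 := (le_abs_self _).trans (hR _ h)
    gcongr
    exact h3.trans (by gcongr)
  have h5 : √(bergmanConst n) ≤ √(Kr (act B z)) := Real.sqrt_le_sqrt (bergmanConst_le_Kr hBz)
  have h6 : 0 < √(bergmanConst n) := Real.sqrt_pos.2 hκ
  rw [h1, ← sqrt_Kr_act (presHerm hB) hz, mul_pow]
  calc _ ≤ R ^ k * S * ‖jac B z‖ ^ k := by gcongr
    _ = R ^ k * S * (√(bergmanConst n) ^ k)⁻¹ * (√(bergmanConst n) ^ k * ‖jac B z‖ ^ k) := by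
      field_simp
    _ ≤ _ := by gcongr

end IsFundDom

end

section

open DiscreteGroup

/-- The weight `K(z,z)^(1-k)` of the inner product, with respect to Euclidean volume. -/
def wgt (k : ℕ) (z : Fin n → ℂ) : ℝ := Kr z ^ ((1 : ℤ) - (k : ℤ))

lemma measurable_wgt (k : ℕ) : Measurable (wgt k : (Fin n → ℂ) → ℝ) :=
  (measurable_Kr.pow_const ((1 : ℤ) - (k : ℤ)))

lemma wgt_pos (k : ℕ) {z : Fin n → ℂ} (hz : z ∈ ball n) : 0 < wgt k z := zpow_pos (Kr_pos hz) _

lemma sqrt_Kr_pow_mul_wgt {k : ℕ} (hk : 2 ≤ k) {z : Fin n → ℂ} (hz : z ∈ ball n) :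
    √(Kr z) ^ k * √(Kr z) ^ k * wgt k z = Kr z := by
  obtain ⟨j, rfl⟩ : ∃ j, k = j + 1 := ⟨k - 1, by omega⟩
  have := Kr_pos hz
  rw [wgt, Kr_zpow (by omega), ← mul_pow, Real.mul_self_sqrt this.le, Nat.add_sub_cancel, pow_succ]
  field_simp

lemma sqrt_Kr_pow_mul_wgt_le {k : ℕ} (hk : 2 ≤ k) {z : Fin n → ℂ} (hz : z ∈ ball n) :
    √(Kr z) ^ k * wgt k z ≤ (√(bergmanConst n) ^ (k - 2))⁻¹ := by
  rw [wgt, Kr_zpow (by omega)]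
  exact sqrt_Kr_pow_mul_le hk hz

lemma wgt_act {k : ℕ} (hk : 2 ≤ k) {A : Matrix (Fin (n + 1)) (Fin (n + 1)) ℂ} (hA : PresHerm A)
    {z : Fin n → ℂ} (hz : z ∈ ball n) :
    wgt k (act A z) * ‖jac A z‖ ^ 2 = wgt k z * ‖jac A z‖ ^ (2 * k) := by
  obtain ⟨j, rfl⟩ : ∃ j, k = j + 1 := ⟨k - 1, by omega⟩
  have h1 := Kr_pos (hA.act_mem hz)
  have h2 : 0 < ‖jac A z‖ := norm_pos_iff.2 (hA.jac_ne_zero hz)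
  rw [wgt, wgt, Kr_zpow (by omega), Kr_zpow (by omega), ← hA.Kr_act hz, Nat.add_sub_cancel, mul_pow]
  field_simp
  ring

/-- The bound `C` with `|K(z,w)| ≤ C` for all `z` in the ball. -/
def kerBound (w : Fin n → ℂ) : ℝ := bergmanConst n * (2 * (defect w)⁻¹) ^ (n + 1)

lemma kerBound_nonneg {w : Fin n → ℂ} (hw : w ∈ ball n) : 0 ≤ kerBound w := by
  have := bergmanConst_pos (n := n)
  have := mem_ball_iff.1 hw
  unfold kerBound
  positivity

lemma measurable_Kc : Measurable (Function.uncurry (Kc : (Fin n → ℂ) → (Fin n → ℂ) → ℂ)) := by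
  have hp : Continuous (Function.uncurry (pair : (Fin n → ℂ) → (Fin n → ℂ) → ℂ)) := by
    unfold pair Function.uncurry
    fun_prop
  exact ((hp.measurable.neg.inv).pow_const (n + 1)).const_mul _

/-- The general term of the Poincaré series. -/
def thetaTerm (k : ℕ) (w : Fin n → ℂ) (A : Matrix (Fin (n + 1)) (Fin (n + 1)) ℂ)
    (z : Fin n → ℂ) : ℂ := Kc (act A z) w ^ k * jac A z ^ k

lemma measurable_thetaTerm (k : ℕ) (A : Matrix (Fin (n + 1)) (Fin (n + 1)) ℂ) :
    Measurable fun p : (Fin n → ℂ) × (Fin n → ℂ) => thetaTerm k p.1 A p.2 :=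
  ((measurable_Kc.comp (((measurable_act A).comp measurable_snd).prodMk measurable_fst)).pow_const
    k).mul (((measurable_jac A).comp measurable_snd).pow_const k)

lemma measurable_thetaTerm_right (k : ℕ) (w : Fin n → ℂ)
    (A : Matrix (Fin (n + 1)) (Fin (n + 1)) ℂ) : Measurable (thetaTerm k w A) :=
  Measurable.comp (g := fun p : (Fin n → ℂ) × (Fin n → ℂ) => thetaTerm k p.1 A p.2)
    (f := fun z => (w, z)) (measurable_thetaTerm k A) (measurable_const.prodMk measurable_id)

lemma norm_thetaTerm_le (k : ℕ) {A : Matrix (Fin (n + 1)) (Fin (n + 1)) ℂ} (hA : PresHerm A)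
    {w z : Fin n → ℂ} (hw : w ∈ ball n) (hz : z ∈ ball n) :
    ‖thetaTerm k w A z‖ ≤ kerBound w ^ k * ‖jac A z‖ ^ k := by
  rw [thetaTerm, norm_mul, norm_pow, norm_pow]
  have := norm_Kc_le (hA.act_mem hz) hw
  unfold kerBound
  gcongr

lemma differentiableOn_thetaTerm (k : ℕ) {A : Matrix (Fin (n + 1)) (Fin (n + 1)) ℂ}
    (hA : PresHerm A) {w : Fin n → ℂ} (hw : w ∈ ball n) :
    DifferentiableOn ℂ (thetaTerm k w A) (ball n) := by
  have hK : DifferentiableOn ℂ (fun z => Kc z w) (ball n) := by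
    have h1 : Differentiable ℂ fun z : Fin n → ℂ => pair z w := by
      unfold pair
      fun_prop
    refine ((h1.neg.differentiableOn.inv fun z hz => ?_).pow (n + 1)).const_mul _
    have h2 := defect_half_le_norm_pair hz hw
    have h3 := mem_ball_iff.1 hw
    exact neg_ne_zero.2 (norm_pos_iff.1 (by linarith))
  exact ((hK.comp (differentiableOn_act hA) fun z hz => hA.act_mem hz).pow k).mul
    ((differentiableOn_jac hA).pow k)

lemma ThetaPt_eq (G : DiscreteGroup n) (k : ℕ) (w z : Fin n → ℂ) :
    ThetaPt G k w z = (cB n k : ℂ) * ∑' A : G.Γ, thetaTerm k w A.1 z := rfl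

lemma measurable_ThetaPt (G : DiscreteGroup n) (k : ℕ) :
    Measurable fun p : (Fin n → ℂ) × (Fin n → ℂ) => ThetaPt G k p.1 p.2 := by
  simp_rw [ThetaPt_eq]
  exact (Measurable.tsum fun A : G.Γ => measurable_thetaTerm k A.1).const_mul _

lemma measurable_ThetaPt_right (G : DiscreteGroup n) (k : ℕ) (w : Fin n → ℂ) :
    Measurable (ThetaPt G k w) :=
  Measurable.comp (g := fun p : (Fin n → ℂ) × (Fin n → ℂ) => ThetaPt G k p.1 p.2)
    (f := fun z => (w, z)) (measurable_ThetaPt G k) (measurable_const.prodMk measurable_id)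

lemma thetaTerm_mul (k : ℕ) {A B : Matrix (Fin (n + 1)) (Fin (n + 1)) ℂ} (hA : PresHerm A)
    (hB : PresHerm B) (w : Fin n → ℂ) {z : Fin n → ℂ} (hz : z ∈ ball n) :
    thetaTerm k w (A * B) z = thetaTerm k w A (act B z) * jac B z ^ k := by
  rw [thetaTerm, thetaTerm, hA.jac_mul hB hz, (hA.denom_act_mul hB hz).2, mul_pow, mul_assoc]

lemma automorphic_ThetaPt (G : DiscreteGroup n) (k : ℕ) (w : Fin n → ℂ) :
    Automorphic G k (ThetaPt G k w) := by
  intro B hB z hz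
  have h : ∑' A : G.Γ, thetaTerm k w A.1 z =
      ∑' A : G.Γ, thetaTerm k w A.1 (act B z) * jac B z ^ k := by
    rw [← (mulRightEquiv hB).tsum_eq fun A : G.Γ => thetaTerm k w A.1 z]
    exact tsum_congr fun A => thetaTerm_mul k (presHerm A.2) (presHerm hB) w hz
  rw [ThetaPt_eq, ThetaPt_eq, h, tsum_mul_right, mul_assoc]

namespace IsFundDom

variable {G : DiscreteGroup n} {F : Set (Fin n → ℂ)} (hF : IsFundDom G F)
include hF

lemma summable_norm_thetaTerm {k : ℕ} (hk : 2 ≤ k) {w z : Fin n → ℂ} (hw : w ∈ ball n)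
    (hz : z ∈ ball n) : Summable fun A : G.Γ => ‖thetaTerm k w A.1 z‖ :=
  Summable.of_nonneg_of_le (fun _ => norm_nonneg _)
    (fun A => norm_thetaTerm_le k (presHerm A.2) hw hz) ((hF.summable_jac hk hz).mul_left _)

lemma norm_ThetaPt_le {k : ℕ} (hk : 2 ≤ k) {M : ℝ}
    (hM : ∀ z ∈ ball n, ∑' A : G.Γ, ‖jac A.1 z‖ ^ k ≤ M * √(Kr z) ^ k)
    {w z : Fin n → ℂ} (hw : w ∈ ball n) (hz : z ∈ ball n) :
    ‖ThetaPt G k w z‖ ≤ cB n k * (kerBound w ^ k * M) * √(Kr z) ^ k := by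
  have hs := hF.summable_norm_thetaTerm hk hw hz
  have h0 := kerBound_nonneg hw
  rw [ThetaPt_eq, norm_mul, RCLike.norm_natCast, mul_assoc]
  refine mul_le_mul_of_nonneg_left ?_ (by positivity)
  calc _ ≤ ∑' A : G.Γ, ‖thetaTerm k w A.1 z‖ := norm_tsum_le_tsum_norm hs
    _ ≤ ∑' A : G.Γ, kerBound w ^ k * ‖jac A.1 z‖ ^ k :=
      hs.tsum_le_tsum (fun A => norm_thetaTerm_le k (presHerm A.2) hw hz)
        ((hF.summable_jac hk hz).mul_left _)
    _ ≤ _ := by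
      rw [tsum_mul_left, mul_assoc]
      exact mul_le_mul_of_nonneg_left (hM z hz) (by positivity)

lemma integral_unfold {k : ℕ} (hk : 2 ≤ k) {Φ : (Fin n → ℂ) → ℂ} (hΦm : Measurable Φ)
    (hΦ : Automorphic G k Φ) {Q : ℝ} (hQ0 : 0 ≤ Q) (hQ : ∀ z ∈ ball n, ‖Φ z‖ ≤ Q * √(Kr z) ^ k)
    {w : Fin n → ℂ} (hw : w ∈ ball n) :
    ∫ z in F, Φ z * star (ThetaPt G k w z) * (wgt k z : ℂ) =
      (cB n k : ℂ) * ∫ z in ball n, Φ z * star (Kc z w ^ k) * (wgt k z : ℂ) := by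
  obtain ⟨M, hM0, hM⟩ := hF.exists_tsum_jac_le hk
  have hC := kerBound_nonneg hw
  have hwm : Measurable fun z : Fin n → ℂ => ((wgt k z : ℝ) : ℂ) :=
    Complex.measurable_ofReal.comp (measurable_wgt k)
  have hae : ∀ᵐ z ∂(volume.restrict F), z ∈ ball n :=
    (ae_restrict_mem hF.2.1).mono fun z hz => hF.1 hz
  have hK : Measurable fun z => star (Kc z w ^ k) :=
    continuous_star.measurable.comp
      ((measurable_Kc.comp (measurable_id.prodMk measurable_const)).pow_const k)
  have hsum1 : HasSum (fun A : G.Γ => ∫ z in F, Φ z * star (thetaTerm k w A.1 z) * (wgt k z : ℂ))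
      (∫ z in F, Φ z * star (∑' A : G.Γ, thetaTerm k w A.1 z) * (wgt k z : ℂ)) := by
    refine hasSum_integral_of_dominated_convergence
      (fun A z => Q * √(Kr z) ^ k * wgt k z * kerBound w ^ k * ‖jac A.1 z‖ ^ k) ?_ ?_ ?_ ?_ ?_
    · intro A
      have h1 : Measurable fun z => star (thetaTerm k w A.1 z) :=
        continuous_star.measurable.comp (measurable_thetaTerm_right k w A.1)
      exact ((hΦm.mul h1).mul hwm).aestronglyMeasurable
    · intro A
      filter_upwards [hae] with z hz
      have h1 := norm_thetaTerm_le k (presHerm A.2) hw hz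
      have h2 := wgt_pos k hz
      rw [norm_mul, norm_mul, norm_star, Complex.norm_of_nonneg h2.le]
      calc _ ≤ (Q * √(Kr z) ^ k) * (kerBound w ^ k * ‖jac A.1 z‖ ^ k) * wgt k z := by
            have := hQ z hz
            gcongr
        _ = _ := by ring
    · filter_upwards [hae] with z hz
      exact (hF.summable_jac hk hz).mul_left _
    · have hbm : Measurable fun z => ∑' A : G.Γ,
          Q * √(Kr z) ^ k * wgt k z * kerBound w ^ k * ‖jac A.1 z‖ ^ k := by
        refine Measurable.tsum fun A => ?_
        exact ((((measurable_Kr.sqrt.pow_const k).const_mul Q).mul (measurable_wgt k)).mul_const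
          _).mul ((measurable_jac A.1).norm.pow_const k)
      refine (hF.integrable_Kr.const_mul (Q * kerBound w ^ k * M)).mono'
        hbm.aestronglyMeasurable ?_
      filter_upwards [hae] with z hz
      have h2 := wgt_pos k hz
      rw [tsum_mul_left, Real.norm_of_nonneg
        (mul_nonneg (by positivity) (tsum_nonneg fun A => by positivity))]
      calc _ ≤ Q * √(Kr z) ^ k * wgt k z * kerBound w ^ k * (M * √(Kr z) ^ k) :=
            mul_le_mul_of_nonneg_left (hM z hz) (by positivity)
        _ = Q * kerBound w ^ k * M * (√(Kr z) ^ k * √(Kr z) ^ k * wgt k z) := by ring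
        _ = _ := by rw [sqrt_Kr_pow_mul_wgt hk hz]
    · filter_upwards [hae] with z hz
      have h1 := (hF.summable_norm_thetaTerm hk hw hz).of_norm.hasSum
      exact ((h1.star).mul_left (Φ z)).mul_right _
  have hterm : ∀ A : G.Γ, ∫ z in F, Φ z * star (thetaTerm k w A.1 z) * (wgt k z : ℂ) =
      ∫ z in act A.1 '' F, Φ z * star (Kc z w ^ k) * (wgt k z : ℂ) := by
    intro A
    rw [(presHerm A.2).integral_image hF.2.1 hF.1]
    refine setIntegral_congr_fun hF.2.1 fun z hz => ?_
    have h1 := hΦ A.1 A.2 z (hF.1 hz)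
    have h2 := congrArg (fun x : ℝ => (x : ℂ)) (wgt_act hk (presHerm A.2) (hF.1 hz))
    beta_reduce at h2 ⊢
    rw [← h1, thetaTerm, star_mul']
    have h3 : ((‖jac A.1 z‖ ^ (2 * k) : ℝ) : ℂ) = jac A.1 z ^ k * star (jac A.1 z ^ k) := by
      rw [Complex.star_def, Complex.mul_conj', norm_pow]; push_cast; ring
    rw [Complex.ofReal_mul, Complex.ofReal_mul, h3] at h2
    linear_combination (-(Φ (act A.1 z) * star (Kc (act A.1 z) w ^ k))) * h2
  simp_rw [hterm] at hsum1
  have hint : IntegrableOn (fun z => Φ z * star (Kc z w ^ k) * (wgt k z : ℂ)) (ball n) := by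
    have hc : IntegrableOn (fun _ : Fin n → ℂ => Q * kerBound w ^ k *
        (√(bergmanConst n) ^ (k - 2))⁻¹) (ball n) := integrableOn_const volume_ball_ne_top
    refine hc.mono' ((hΦm.mul hK).mul hwm).aestronglyMeasurable ?_
    filter_upwards [ae_restrict_mem measurableSet_ball] with z hz
    have h2 := wgt_pos k hz
    have h3 : ‖Kc z w‖ ≤ kerBound w := norm_Kc_le hz hw
    rw [norm_mul, norm_mul, norm_star, norm_pow, Complex.norm_of_nonneg h2.le]
    calc _ ≤ (Q * √(Kr z) ^ k) * kerBound w ^ k * wgt k z := by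
          have := hQ z hz
          gcongr
      _ = Q * kerBound w ^ k * (√(Kr z) ^ k * wgt k z) := by ring
      _ ≤ _ := mul_le_mul_of_nonneg_left (sqrt_Kr_pow_mul_wgt_le hk hz) (by positivity)
  have hsum2 := hasSum_integral_iUnion_ae (fun A => (hF.measurableSet_image A).nullMeasurableSet)
    hF.aedisjoint (hF.iUnion_image ▸ hint)
  rw [hF.iUnion_image] at hsum2
  rw [hsum2.unique hsum1, ← integral_const_mul]
  refine setIntegral_congr_fun hF.2.1 fun z hz => ?_
  simp only [ThetaPt_eq, star_mul', star_natCast]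
  ring

/-- The Poincaré series represent point evaluations on one another. -/
lemma integral_ThetaPt_mul_star (hn : 0 < n) {k : ℕ} (hk : 2 ≤ k) {w : Fin n → ℂ}
    (hw : w ∈ ball n) {B : Matrix (Fin (n + 1)) (Fin (n + 1)) ℂ} (hB : PresHerm B) :
    ∫ z in F, ThetaPt G k w z * star (ThetaPt G k (act B 0) z) * (wgt k z : ℂ) =
      ThetaPt G k w (act B 0) := by
  obtain ⟨M, hM0, hM⟩ := hF.exists_tsum_jac_le hk
  have hC := kerBound_nonneg hw
  set x := act B 0 with hx
  have hxb : x ∈ ball n := hB.act_mem zero_mem_ball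
  have hCx := kerBound_nonneg hxb
  rw [hF.integral_unfold hk (measurable_ThetaPt_right G k w)
    (automorphic_ThetaPt G k w) (Q := cB n k * (kerBound w ^ k * M)) (by positivity)
    (fun z hz => hF.norm_ThetaPt_le hk hM hw hz) hxb]
  have hwm : Measurable fun z : Fin n → ℂ => ((wgt k z : ℝ) : ℂ) :=
    Complex.measurable_ofReal.comp (measurable_wgt k)
  have hae : ∀ᵐ z ∂(volume.restrict (ball n)), z ∈ ball n := ae_restrict_mem measurableSet_ball
  have hK : Measurable fun z => star (Kc z x ^ k) :=
    continuous_star.measurable.comp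
      ((measurable_Kc.comp (measurable_id.prodMk measurable_const)).pow_const k)
  have hsum : HasSum
      (fun A : G.Γ => ∫ z in ball n, thetaTerm k w A.1 z * star (Kc z x ^ k) * (wgt k z : ℂ))
      (∫ z in ball n, (∑' A : G.Γ, thetaTerm k w A.1 z) * star (Kc z x ^ k) * (wgt k z : ℂ)) := by
    refine hasSum_integral_of_dominated_convergence
      (fun A z => kerBound x ^ k * wgt k z * kerBound w ^ k * ‖jac A.1 z‖ ^ k) ?_ ?_ ?_ ?_ ?_
    · intro A
      exact (((measurable_thetaTerm_right k w A.1).mul hK).mul hwm).aestronglyMeasurable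
    · intro A
      filter_upwards [hae] with z hz
      have h1 := norm_thetaTerm_le k (presHerm A.2) hw hz
      have h2 := wgt_pos k hz
      have h3 : ‖Kc z x‖ ≤ kerBound x := norm_Kc_le hz hxb
      rw [norm_mul, norm_mul, norm_star, norm_pow, Complex.norm_of_nonneg h2.le]
      calc _ ≤ (kerBound w ^ k * ‖jac A.1 z‖ ^ k) * kerBound x ^ k * wgt k z := by gcongr
        _ = _ := by ring
    · filter_upwards [hae] with z hz
      exact (hF.summable_jac hk hz).mul_left _
    · have hbm : Measurable fun z => ∑' A : G.Γ,
          kerBound x ^ k * wgt k z * kerBound w ^ k * ‖jac A.1 z‖ ^ k := by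
        refine Measurable.tsum fun A => ?_
        exact (((measurable_wgt k).const_mul _).mul_const _).mul
          ((measurable_jac A.1).norm.pow_const k)
      have hc : IntegrableOn (fun _ : Fin n → ℂ => kerBound x ^ k * kerBound w ^ k * M *
        (√(bergmanConst n) ^ (k - 2))⁻¹) (ball n) := integrableOn_const volume_ball_ne_top
      refine hc.mono' hbm.aestronglyMeasurable ?_
      filter_upwards [hae] with z hz
      have h2 := wgt_pos k hz
      rw [tsum_mul_left, Real.norm_of_nonneg
        (mul_nonneg (by positivity) (tsum_nonneg fun A => by positivity))]
      calc _ ≤ kerBound x ^ k * wgt k z * kerBound w ^ k * (M * √(Kr z) ^ k) :=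
            mul_le_mul_of_nonneg_left (hM z hz) (by positivity)
        _ = kerBound x ^ k * kerBound w ^ k * M * (√(Kr z) ^ k * wgt k z) := by ring
        _ ≤ _ := mul_le_mul_of_nonneg_left (sqrt_Kr_pow_mul_wgt_le hk hz) (by positivity)
    · filter_upwards [hae] with z hz
      have h1 := (hF.summable_norm_thetaTerm hk hw hz).of_norm.hasSum
      exact (h1.mul_right _).mul_right _
  have hterm : ∀ A : G.Γ, (cB n k : ℂ) *
      ∫ z in ball n, thetaTerm k w A.1 z * star (Kc z x ^ k) * (wgt k z : ℂ) =
      thetaTerm k w A.1 x := by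
    intro A
    refine reproducing hn hk (differentiableOn_thetaTerm k (presHerm A.2) hw)
      (M := kerBound w ^ k * M) (fun z hz => ?_) hB
    refine (norm_thetaTerm_le k (presHerm A.2) hw hz).trans ?_
    rw [mul_assoc]
    refine mul_le_mul_of_nonneg_left (le_trans ?_ (hM z hz)) (by positivity)
    exact (hF.summable_jac hk hz).le_tsum A fun _ _ => by positivity
  have hsum' := hsum.mul_left (cB n k : ℂ)
  simp_rw [hterm] at hsum'
  rw [ThetaPt_eq, hsum'.tsum_eq]
  congr 1
  rw [← integral_const_mul]
  refine setIntegral_congr_fun measurableSet_ball fun z hz => ?_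
  simp only [ThetaPt_eq]
  ring

end IsFundDom

end

section

lemma herm_zero_left (v : Fin (n + 1) → ℂ) : herm 0 v = 0 := by simp [herm]

lemma herm_zero_right (v : Fin (n + 1) → ℂ) : herm v 0 = 0 := by simp [herm]

lemma herm_sum_left {ι : Type*} (s : Finset ι) (f : ι → Fin (n + 1) → ℂ) (v : Fin (n + 1) → ℂ) :
    herm (∑ i ∈ s, f i) v = ∑ i ∈ s, herm (f i) v := by
  classical
  induction s using Finset.induction_on with
  | empty => simp [herm_zero_left]
  | insert a s ha ih => rw [Finset.sum_insert ha, Finset.sum_insert ha, herm_add_left, ih]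

lemma herm_sum_right {ι : Type*} (s : Finset ι) (f : ι → Fin (n + 1) → ℂ) (v : Fin (n + 1) → ℂ) :
    herm v (∑ i ∈ s, f i) = ∑ i ∈ s, herm v (f i) := by
  classical
  induction s using Finset.induction_on with
  | empty => simp [herm_zero_right]
  | insert a s ha ih => rw [Finset.sum_insert ha, Finset.sum_insert ha, herm_add_right, ih]

/-- A matrix whose columns are orthonormal for the form of signature `(n,1)` preserves it. -/
lemma presHerm_of_columns {A : Matrix (Fin (n + 1)) (Fin (n + 1)) ℂ}
    (h : ∀ j l, herm (A.col j) (A.col l) =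
      if j = l then (if j = Fin.last n then -1 else 1) else 0) : PresHerm A := by
  intro u v
  have e : ∀ w : Fin (n + 1) → ℂ, A.mulVec w = ∑ j, w j • A.col j := fun w => by
    ext i
    simp [Matrix.mulVec, dotProduct, Finset.sum_apply, mul_comm]
  rw [e u, e v, herm_sum_left]
  simp_rw [herm_sum_right, herm_smul_left, herm_smul_right, h]
  simp only [mul_ite, mul_one, mul_zero, Finset.sum_ite_eq, Finset.mem_univ, if_true]
  rw [Fin.sum_univ_castSucc, herm]
  simp only [Fin.ne_of_lt (Fin.castSucc_lt_last _), if_false, if_true]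
  ring

lemma herm_single (i j : Fin (n + 1)) :
    herm (Pi.single i 1) (Pi.single j 1) = if i = j then (if i = Fin.last n then -1 else 1) else 0 := by
  have h : herm (Pi.single i 1) (Pi.single j 1 : Fin (n + 1) → ℂ) =
      (∑ l : Fin (n + 1), (Pi.single i 1 : Fin (n + 1) → ℂ) l * star ((Pi.single j 1 : Fin (n + 1) → ℂ) l))
        - 2 * ((Pi.single i 1 : Fin (n + 1) → ℂ) (Fin.last n) *
          star ((Pi.single j 1 : Fin (n + 1) → ℂ) (Fin.last n))) := by
    rw [Fin.sum_univ_castSucc, herm]; ring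
  rw [h]
  simp only [Pi.single_apply, ite_mul, one_mul, zero_mul, Finset.sum_ite_eq', Finset.mem_univ,
    if_true]
  by_cases hij : i = j
  · subst hij
    by_cases hi : i = Fin.last n
    · rw [if_pos hi]
      simp [hi]
      norm_num
    · rw [if_neg hi]
      simp [Ne.symm hi]
  · rw [if_neg hij, if_neg hij]
    by_cases hi : i = Fin.last n
    · subst hi
      simp [hij]
    · simp [Ne.symm hi]

/-- The hyperbolic translation along `C̃₀` taking `0` to `(0, …, 0, x)`. -/
def boostMat (n : ℕ) (hn : 0 < n) (x : ℝ) : Matrix (Fin (n + 1)) (Fin (n + 1)) ℂ :=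
  Matrix.of fun i j =>
    if j = (lastI n hn).castSucc then
      (((√(1 - x ^ 2))⁻¹ : ℝ) : ℂ) * ((Pi.single (lastI n hn).castSucc 1 : Fin (n + 1) → ℂ) i +
        x * (Pi.single (Fin.last n) 1 : Fin (n + 1) → ℂ) i)
    else if j = Fin.last n then
      (((√(1 - x ^ 2))⁻¹ : ℝ) : ℂ) * (x * (Pi.single (lastI n hn).castSucc 1 : Fin (n + 1) → ℂ) i +
        (Pi.single (Fin.last n) 1 : Fin (n + 1) → ℂ) i)
    else (Pi.single j 1 : Fin (n + 1) → ℂ) i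

section boost

variable (hn : 0 < n) {x : ℝ}

lemma boostMat_col (j : Fin (n + 1)) : (boostMat n hn x).col j =
    if j = (lastI n hn).castSucc then
      (((√(1 - x ^ 2))⁻¹ : ℝ) : ℂ) • (Pi.single (lastI n hn).castSucc 1 +
        (x : ℂ) • (Pi.single (Fin.last n) 1 : Fin (n + 1) → ℂ))
    else if j = Fin.last n then
      (((√(1 - x ^ 2))⁻¹ : ℝ) : ℂ) • ((x : ℂ) • (Pi.single (lastI n hn).castSucc 1) +
        (Pi.single (Fin.last n) 1 : Fin (n + 1) → ℂ))
    else Pi.single j 1 := by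
  ext i
  simp only [Matrix.col_apply, boostMat, Matrix.of_apply]
  split_ifs <;> simp

lemma presHerm_boostMat (hx : x ^ 2 < 1) : PresHerm (boostMat n hn x) := by
  refine presHerm_of_columns fun j l => ?_
  have hpl : (lastI n hn).castSucc ≠ Fin.last n := Fin.ne_of_lt (Fin.castSucc_lt_last _)
  have hc : (((√(1 - x ^ 2))⁻¹ : ℝ) : ℂ) * (((√(1 - x ^ 2))⁻¹ : ℝ) : ℂ) * (1 - x * x) = 1 := by
    have h : (√(1 - x ^ 2))⁻¹ * (√(1 - x ^ 2))⁻¹ * (1 - x * x) = 1 := by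
      rw [← mul_inv, Real.mul_self_sqrt (by linarith), ← sq, inv_mul_cancel₀ (by linarith)]
    exact_mod_cast h
  rw [boostMat_col, boostMat_col]
  have hcs : star (((√(1 - x ^ 2))⁻¹ : ℝ) : ℂ) = (((√(1 - x ^ 2))⁻¹ : ℝ) : ℂ) :=
    Complex.conj_ofReal _
  have hxs : star (x : ℂ) = x := Complex.conj_ofReal _
  generalize (((√(1 - x ^ 2))⁻¹ : ℝ) : ℂ) = c at *
  generalize (lastI n hn).castSucc = p at *
  have h3 : ∀ i : Fin (n + 1), i = p ∨ i = Fin.last n ∨ (i ≠ p ∧ i ≠ Fin.last n) := by tauto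
  rcases h3 j with rfl | rfl | ⟨hj, hj'⟩ <;> rcases h3 l with rfl | rfl | ⟨hl, hl'⟩ <;>
    simp only [*, Ne.symm hpl, if_true, if_false, herm_smul_left, herm_smul_right, herm_add_left,
      herm_add_right, herm_single, mul_zero, mul_one, add_zero, zero_add]
  · linear_combination hc
  · ring
  · simp [Ne.symm hl, Ne.symm hl']
  · ring
  · linear_combination -hc
  · simp [Ne.symm hl, Ne.symm hl']

lemma boostMat_act_zero (hx : x ^ 2 < 1) : act (boostMat n hn x) 0 = curve n hn x := by
  have hc : (((√(1 - x ^ 2))⁻¹ : ℝ) : ℂ) ≠ 0 := by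
    have : 0 < √(1 - x ^ 2) := Real.sqrt_pos.2 (by linarith)
    exact_mod_cast (inv_pos.2 this).ne'
  refine (act_eq_of_mulVec hc ?_).2
  have h0 : snoc1 (0 : Fin n → ℂ) = Pi.single (Fin.last n) 1 := by
    ext i
    refine Fin.lastCases ?_ (fun i => ?_) i
    · simp
    · simp
  rw [h0, Matrix.mulVec_single_one, boostMat_col, if_neg (Fin.ne_of_lt (Fin.castSucc_lt_last _)).symm,
    if_pos rfl]
  congr 1
  ext i
  refine Fin.lastCases ?_ (fun i => ?_) i
  · simp
  · simp [curve, Pi.single_apply]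

end boost

end

section

lemma pair_self_eq_zero {X : Fin n → ℂ} (hX : ∑ i, ‖X i‖ ^ 2 = 1) : pair X X = 0 := by
  rw [pair_self, defect, hX]; simp

lemma pair_real {X Y : Fin n → ℂ} (hX : ∀ i, (X i).im = 0) (hY : ∀ i, (Y i).im = 0) :
    pair X Y = ((∑ i, (X i).re * (Y i).re - 1 : ℝ) : ℂ) := by
  have h : ∀ i, X i * star (Y i) = (((X i).re * (Y i).re : ℝ) : ℂ) := fun i => by
    apply Complex.ext
    · simp [hX i]
    · simp [hX i, hY i]
  rw [pair]
  simp_rw [h]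
  push_cast
  rfl

lemma norm_sq_of_im_eq_zero {z : ℂ} (h : z.im = 0) : ‖z‖ ^ 2 = z.re ^ 2 := by
  rw [Complex.sq_norm, Complex.normSq_apply, h]; ring

lemma herm_eq_zero_of_eigen {γ : Matrix (Fin (n + 1)) (Fin (n + 1)) ℂ} (hγ : PresHerm γ)
    {u v : Fin (n + 1) → ℂ} {a : ℂ} {b : ℝ} (hu : γ.mulVec u = a • u)
    (hv : γ.mulVec v = (b : ℂ) • v) (h : a * b ≠ 1) : herm u v = 0 := by
  have h1 := hγ u v
  have hb : star (b : ℂ) = b := Complex.conj_ofReal b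
  rw [hu, hv, herm_smul_left, herm_smul_right, hb] at h1
  have h2 : (a * b - 1) * herm u v = 0 := by linear_combination h1
  exact (mul_eq_zero.1 h2).resolve_left (sub_ne_zero.2 h)

namespace HypElt

variable {G : DiscreteGroup n} (H : HypElt n G)

/-- The real number `⟨X,Y⟩`. -/
def pairXY : ℝ := ∑ i, (H.X i).re * (H.Y i).re - 1

lemma pair_eq : pair H.X H.Y = (H.pairXY : ℂ) := pair_real H.X_real H.Y_real

lemma lam_ne_zero : H.lam ≠ 0 := by
  have := H.lam_sq
  rintro h
  rw [h] at this
  norm_num at this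

lemma X_ne_Y : H.X ≠ H.Y := by
  intro h
  have h1 := H.eigX
  rw [h, H.eigY] at h1
  have h2 := congrFun h1 (Fin.last n)
  simp only [Pi.smul_apply, snoc1_last, smul_eq_mul, mul_one] at h2
  have h3 : H.lam⁻¹ = H.lam := by exact_mod_cast h2
  have h4 := mul_inv_cancel₀ H.lam_ne_zero
  rw [h3] at h4
  have := H.lam_sq
  nlinarith

lemma pairXY_neg : H.pairXY < 0 := by
  have hX := H.X_bd
  have hY := H.Y_bd
  simp_rw [norm_sq_of_im_eq_zero (H.X_real _)] at hX
  simp_rw [norm_sq_of_im_eq_zero (H.Y_real _)] at hY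
  have h1 : ∑ i, ((H.X i).re - (H.Y i).re) ^ 2 = -2 * H.pairXY := by
    have : ∀ i, ((H.X i).re - (H.Y i).re) ^ 2 =
        (H.X i).re ^ 2 + (H.Y i).re ^ 2 - 2 * ((H.X i).re * (H.Y i).re) := fun i => by ring
    simp_rw [this]
    rw [Finset.sum_sub_distrib, Finset.sum_add_distrib, hX, hY, ← Finset.mul_sum, pairXY]
    ring
  have h2 : 0 < ∑ i, ((H.X i).re - (H.Y i).re) ^ 2 := by
    refine lt_of_le_of_ne (by positivity) fun h => H.X_ne_Y ?_
    ext i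
    have h3 := (Finset.sum_eq_zero_iff_of_nonneg fun i _ => sq_nonneg _).1 h.symm i
      (Finset.mem_univ i)
    apply Complex.ext
    · nlinarith
    · rw [H.X_real, H.Y_real]
  linarith

lemma T_pos : 0 < H.T := by
  have := H.lam_sq
  unfold T
  apply div_pos <;> linarith

lemma T_lt_one : H.T < 1 := by
  have := H.lam_sq
  unfold T
  rw [div_lt_one (by linarith)]
  linarith

lemma herm_v_X (j : Fin (n - 1)) : herm (H.v j) (snoc1 H.X) = 0 := by
  refine herm_eq_zero_of_eigen (G.sub_SU H.mem).2 (H.v_eig j) H.eigX ?_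
  have h0 := H.lam_sq
  rcases H.alph_pm j with h | h <;> rw [h] <;> intro h1
  · have : H.lam = 1 := by rw [one_mul] at h1; exact_mod_cast h1
    rw [this] at h0; norm_num at h0
  · have : -1 * H.lam = 1 := by exact_mod_cast h1
    nlinarith

lemma herm_v_Y (j : Fin (n - 1)) : herm (H.v j) (snoc1 H.Y) = 0 := by
  have hY : H.γ.mulVec (snoc1 H.Y) = ((H.lam⁻¹ : ℝ) : ℂ) • snoc1 H.Y := by
    rw [H.eigY]; push_cast; rfl
  refine herm_eq_zero_of_eigen (G.sub_SU H.mem).2 (H.v_eig j) hY ?_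
  have h0 := H.lam_sq
  have hm := mul_inv_cancel₀ H.lam_ne_zero
  rcases H.alph_pm j with h | h <;> rw [h] <;> intro h1
  · have h2 : H.lam⁻¹ = 1 := by rw [one_mul] at h1; exact_mod_cast h1
    rw [h2] at hm
    nlinarith
  · have h2 : -1 * H.lam⁻¹ = 1 := by exact_mod_cast h1
    have h3 : H.lam⁻¹ = -1 := by linarith
    rw [h3] at hm
    nlinarith

lemma A_col (j : Fin (n + 1)) : H.A.col j =
    if h : (j : ℕ) < n - 1 then H.v ⟨j, h⟩
    else if (j : ℕ) = n - 1 then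
      ((H.pairXY⁻¹ : ℝ) : ℂ) • snoc1 H.X + ((2⁻¹ : ℝ) : ℂ) • snoc1 H.Y
    else ((H.pairXY⁻¹ : ℝ) : ℂ) • snoc1 H.X + ((-2⁻¹ : ℝ) : ℂ) • snoc1 H.Y := by
  ext i
  simp only [Matrix.col_apply, A, Amat, Matrix.of_apply, H.pair_eq]
  split_ifs
  · rfl
  · push_cast; rfl
  · simp [sub_eq_add_neg]

lemma presHerm_A (hn : 0 < n) : PresHerm H.A := by
  refine presHerm_of_columns fun j l => ?_
  have hp := H.pairXY_neg
  have hXX : herm (snoc1 H.X) (snoc1 H.X) = 0 := by rw [herm_snoc1, pair_self_eq_zero H.X_bd]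
  have hYY : herm (snoc1 H.Y) (snoc1 H.Y) = 0 := by rw [herm_snoc1, pair_self_eq_zero H.Y_bd]
  have hXY : herm (snoc1 H.X) (snoc1 H.Y) = (H.pairXY : ℂ) := by rw [herm_snoc1, H.pair_eq]
  have hYX : herm (snoc1 H.Y) (snoc1 H.X) = (H.pairXY : ℂ) := by
    rw [← herm_conj, hXY]; exact Complex.conj_ofReal _
  have hXv : ∀ j, herm (snoc1 H.X) (H.v j) = 0 := fun j => by
    rw [← herm_conj, H.herm_v_X, star_zero]
  have hYv : ∀ j, herm (snoc1 H.Y) (H.v j) = 0 := fun j => by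
    rw [← herm_conj, H.herm_v_Y, star_zero]
  have hs : ∀ r : ℝ, star (r : ℂ) = r := Complex.conj_ofReal
  have hp' : (H.pairXY : ℂ) ≠ 0 := by exact_mod_cast hp.ne
  have hj := j.is_lt
  have hl := l.is_lt
  have e : ∀ i : Fin (n + 1), i = Fin.last n ↔ (i : ℕ) = n := fun i => by
    rw [Fin.ext_iff, Fin.val_last]
  rw [H.A_col, H.A_col]
  simp only [e, Fin.ext_iff (a := j)]
  by_cases hj1 : (j : ℕ) < n - 1 <;> by_cases hl1 : (l : ℕ) < n - 1
  · rw [dif_pos hj1, dif_pos hl1, H.v_on]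
    have : ¬ (j : ℕ) = n := by omega
    simp [Fin.ext_iff, this]
  · have : ¬ (j : ℕ) = l := by omega
    rw [dif_pos hj1, dif_neg hl1, if_neg this]
    split_ifs <;> simp only [herm_add_right, herm_smul_right, H.herm_v_X, H.herm_v_Y, mul_zero,
      add_zero]
  · have : ¬ (j : ℕ) = l := by omega
    rw [dif_neg hj1, dif_pos hl1, if_neg this]
    split_ifs <;> simp only [herm_add_left, herm_smul_left, hXv, hYv, mul_zero, add_zero]
  · rw [dif_neg hj1, dif_neg hl1]
    by_cases hj2 : (j : ℕ) = n - 1 <;> by_cases hl2 : (l : ℕ) = n - 1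
    · rw [if_pos hj2, if_pos hl2, if_pos (by omega), if_neg (by omega)]
      simp only [herm_add_left, herm_add_right, herm_smul_left, herm_smul_right, hXX, hYY, hXY,
        hYX, hs]
      push_cast
      field_simp
      ring
    · rw [if_pos hj2, if_neg hl2, if_neg (by omega)]
      simp only [herm_add_left, herm_add_right, herm_smul_left, herm_smul_right, hXX, hYY, hXY,
        hYX, hs]
      push_cast
      ring
    · rw [if_neg hj2, if_pos hl2, if_neg (by omega)]
      simp only [herm_add_left, herm_add_right, herm_smul_left, herm_smul_right, hXX, hYY, hXY,
        hYX, hs]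
      push_cast
      ring
    · rw [if_neg hj2, if_neg hl2, if_pos (by omega), if_pos (by omega)]
      simp only [herm_add_left, herm_add_right, herm_smul_left, herm_smul_right, hXX, hYY, hXY,
        hYX, hs]
      push_cast
      field_simp
      ring

lemma denom_A_curve (hn : 0 < n) (x : ℝ) : denom H.A (curve n hn x) =
    ((H.pairXY⁻¹ * (1 + x) - (1 - x) / 2 : ℝ) : ℂ) := by
  have h1 : H.A (Fin.last n) (lastI n hn).castSucc = ((H.pairXY⁻¹ + 2⁻¹ : ℝ) : ℂ) := by
    have h := congrFun (H.A_col (lastI n hn).castSucc) (Fin.last n)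
    rw [dif_neg (by simp [lastI]), if_pos (by simp [lastI])] at h
    refine h.trans ?_
    simp
  have h2 : H.A (Fin.last n) (Fin.last n) = ((H.pairXY⁻¹ - 2⁻¹ : ℝ) : ℂ) := by
    have h := congrFun (H.A_col (Fin.last n)) (Fin.last n)
    rw [dif_neg (by simp), if_neg (by rw [Fin.val_last]; omega)] at h
    refine h.trans ?_
    simp [sub_eq_add_neg]
  rw [denom, h2]
  simp only [curve, mul_ite, mul_zero, Finset.sum_ite_eq', Finset.mem_univ, if_true]
  rw [h1]
  push_cast
  ring

/-- Along the geodesic the automorphy factor of `A_γ` has constant argument. -/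
lemma jac_A_mul_star (hn : 0 < n) {u x : ℝ} (hu : |u| < 1) (hx : |x| < 1) :
    jac H.A (curve n hn u) * star (jac H.A (curve n hn x)) =
      ((‖jac H.A (curve n hn u)‖ * ‖jac H.A (curve n hn x)‖ : ℝ) : ℂ) := by
  have neg : ∀ {y : ℝ}, |y| < 1 → H.pairXY⁻¹ * (1 + y) - (1 - y) / 2 < 0 := fun {y} hy => by
    have h1 := abs_lt.1 hy
    have h2 := inv_lt_zero.2 H.pairXY_neg
    nlinarith
  have key : ∀ y, jac H.A (curve n hn y) =
      (((H.pairXY⁻¹ * (1 + y) - (1 - y) / 2)⁻¹ ^ (n + 1) : ℝ) : ℂ) := fun y => by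
    rw [jac, denom_A_curve]; push_cast; rfl
  rw [key, key, Complex.norm_real, Complex.norm_real, Complex.star_def, Complex.conj_ofReal,
    ← norm_mul, ← mul_pow, Real.norm_of_nonneg, ← Complex.ofReal_mul, ← mul_pow]
  exact pow_nonneg (mul_nonneg_of_nonpos_of_nonpos (inv_lt_zero.2 (neg hu)).le
    (inv_lt_zero.2 (neg hx)).le) _

end HypElt

end

section

/-- Fubini for the squared norm of a parametrized integral. -/
lemma integral_integral_mul_star {α E : Type*} [MeasurableSpace α] [MeasurableSpace E]
    {μ : Measure α} [IsFiniteMeasure μ] {ν : Measure E} [SFinite ν] {f : α → E → ℂ}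
    (hf : Measurable fun p : α × E => f p.1 p.2) {C : ℝ} {s w : E → ℝ}
    (hs : Measurable s) (hw : Measurable w)
    (hs0 : ∀ᵐ z ∂ν, 0 ≤ s z) (hw0 : ∀ᵐ z ∂ν, 0 ≤ w z)
    (hbound : ∀ᵐ x ∂μ, ∀ᵐ z ∂ν, ‖f x z‖ ≤ C * s z)
    (hint : Integrable (fun z => s z * s z * w z) ν) :
    ∫ z, (∫ u, f u z ∂μ) * star (∫ x, f x z ∂μ) * (w z : ℂ) ∂ν =
      ∫ u, ∫ x, ∫ z, f u z * star (f x z) * (w z : ℂ) ∂ν ∂μ ∂μ := by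
  have hwc : Measurable fun z => ((w z : ℝ) : ℂ) := Complex.measurable_ofReal.comp hw
  have hm1 : Measurable fun q : (α × α) × E => f q.1.1 q.2 :=
    hf.comp ((measurable_fst.comp measurable_fst).prodMk measurable_snd)
  have hm2 : Measurable fun q : (α × α) × E => f q.1.2 q.2 :=
    hf.comp ((measurable_snd.comp measurable_fst).prodMk measurable_snd)
  have hm2' : Measurable fun q : (α × α) × E => star (f q.1.2 q.2) :=
    continuous_star.measurable.comp hm2
  have hm : Measurable fun q : (α × α) × E => f q.1.1 q.2 * star (f q.1.2 q.2) * (w q.2 : ℂ) :=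
    (hm1.mul hm2').mul (hwc.comp measurable_snd)
  have hfm : ∀ x, Measurable (f x) := fun x => hf.comp (measurable_const.prodMk measurable_id)
  have hb1 : ∀ᵐ p ∂(μ.prod μ), ∀ᵐ z ∂ν, ‖f p.1 z‖ ≤ C * s z :=
    Measure.quasiMeasurePreserving_fst.ae hbound
  have hb2 : ∀ᵐ p ∂(μ.prod μ), ∀ᵐ z ∂ν, ‖f p.2 z‖ ≤ C * s z :=
    Measure.quasiMeasurePreserving_snd.ae hbound
  have hb : ∀ᵐ p ∂(μ.prod μ), ∀ᵐ z ∂ν,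
      ‖f p.1 z * star (f p.2 z) * (w z : ℂ)‖ ≤ C * C * (s z * s z * w z) := by
    filter_upwards [hb1, hb2] with p h1 h2
    filter_upwards [h1, h2, hs0, hw0] with z h1 h2 h3 h4
    rw [norm_mul, norm_mul, norm_star, Complex.norm_of_nonneg h4]
    calc _ ≤ (C * s z) * (C * s z) * w z :=
          mul_le_mul_of_nonneg_right (mul_le_mul h1 h2 (norm_nonneg _)
            ((norm_nonneg _).trans h1)) h4
      _ = _ := by ring
  have hI : Integrable (fun q : (α × α) × E => f q.1.1 q.2 * star (f q.1.2 q.2) * (w q.2 : ℂ))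
      ((μ.prod μ).prod ν) := by
    refine ((hint.const_mul (C * C)).comp_snd (μ.prod μ)).mono' hm.aestronglyMeasurable ?_
    rw [Measure.ae_prod_iff_ae_ae]
    · exact hb
    · exact measurableSet_le hm.norm
        (((hs.mul hs).mul hw).const_mul (C * C) |>.comp measurable_snd)
  calc _ = ∫ z, ∫ p, f p.1 z * star (f p.2 z) * (w z : ℂ) ∂(μ.prod μ) ∂ν := by
        refine integral_congr_ae (Eventually.of_forall fun z => ?_)
        beta_reduce
        rw [integral_mul_const, integral_prod_mul (fun u => f u z) fun x => star (f x z)]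
        congr 2
        exact (integral_conj (f := fun x => f x z)).symm
    _ = ∫ p, ∫ z, f p.1 z * star (f p.2 z) * (w z : ℂ) ∂ν ∂(μ.prod μ) :=
        (integral_integral_swap (f := fun (p : α × α) z => f p.1 z * star (f p.2 z) * (w z : ℂ))
          hI).symm
    _ = _ := integral_prod _ hI.integral_prod_left

end

section

lemma rpow_neg_half {x : ℝ} (hx : 0 ≤ x) (k : ℕ) : x ^ (-(k : ℝ) / 2) = (√x ^ k)⁻¹ := by
  rw [Real.sqrt_eq_rpow, ← Real.rpow_natCast, ← Real.rpow_mul hx, ← Real.rpow_neg hx]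
  congr 1
  ring

lemma PresHerm.Kr_rpow_act {A : Matrix (Fin (n + 1)) (Fin (n + 1)) ℂ} (hA : PresHerm A) (k : ℕ)
    {z : Fin n → ℂ} (hz : z ∈ ball n) :
    ‖jac A z‖ ^ k * Kr z ^ (-(k : ℝ) / 2) = Kr (act A z) ^ (-(k : ℝ) / 2) := by
  have h : ‖jac A z‖ ≠ 0 := norm_ne_zero_iff.2 (hA.jac_ne_zero hz)
  rw [rpow_neg_half (Kr_pos hz).le, rpow_neg_half (Kr_pos (hA.act_mem hz)).le,
    ← sqrt_Kr_act hA hz, mul_pow, mul_inv]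
  field_simp

lemma continuous_curve (hn : 0 < n) : Continuous (curve n hn) := by
  refine continuous_pi fun i => ?_
  unfold curve
  split_ifs
  · exact Complex.continuous_ofReal
  · exact continuous_const

lemma curve_mem_ball (hn : 0 < n) {x : ℝ} (hx : |x| < 1) : curve n hn x ∈ ball n := by
  have h : x ^ 2 < 1 := (sq_lt_one_iff_abs_lt_one x).2 hx
  rw [← boostMat_act_zero hn h]
  exact (presHerm_boostMat hn h).act_mem zero_mem_ball

/-- The effect of conjugation by `A` on the terms of the Poincaré series. -/
lemma thetaTerm_conj (k : ℕ) {A B : Matrix (Fin (n + 1)) (Fin (n + 1)) ℂ} (hA : PresHerm A)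
    (hB : PresHerm B) {z w : Fin n → ℂ} (hz : z ∈ ball n) (hw : w ∈ ball n) :
    thetaTerm k w (A⁻¹ * B * A) z =
      thetaTerm k (act A w) B (act A z) * (jac A z * star (jac A w)) ^ k := by
  have hh : PresHerm (A⁻¹ * B * A) := (hA.inv.mul hB).mul hA
  have he : A * (A⁻¹ * B * A) = B * A := by
    rw [← Matrix.mul_assoc, ← Matrix.mul_assoc, Matrix.mul_nonsing_inv _ hA.isUnit_det,
      Matrix.one_mul]
  have h1 : act A (act (A⁻¹ * B * A) z) = act B (act A z) := by
    rw [← (hA.denom_act_mul hh hz).2, he, (hB.denom_act_mul hA hz).2]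
  have h2 : jac A (act (A⁻¹ * B * A) z) * jac (A⁻¹ * B * A) z = jac B (act A z) * jac A z := by
    rw [← hA.jac_mul hh hz, he, hB.jac_mul hA hz]
  have h3 := hA.Kc_act (hh.act_mem hz) hw
  rw [h1] at h3
  rw [thetaTerm, thetaTerm, ← mul_pow, ← mul_pow, ← mul_pow, ← h3]
  congr 1
  linear_combination (Kc (act B (act A z)) (act A w) * star (jac A w)) * h2

namespace HypElt

variable {G : DiscreteGroup n} (H : HypElt n G)

lemma tsum_conjGrp (hn : 0 < n) (f : Matrix (Fin (n + 1)) (Fin (n + 1)) ℂ → ℂ) :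
    ∑' h : ↥(conjGrp G H), f h = ∑' B : G.Γ, f (H.A⁻¹ * B.1 * H.A) := by
  have hu := (H.presHerm_A hn).isUnit_det
  refine tsum_image (g := fun B => H.A⁻¹ * B * H.A) f fun B _ B' _ h => ?_
  have h1 := congrArg (fun M => H.A * M * H.A⁻¹) h
  simpa only [Matrix.mul_assoc, Matrix.mul_nonsing_inv _ hu, Matrix.mul_one,
    ← Matrix.mul_assoc H.A, Matrix.one_mul] using h1

/-- The Poincaré series at points of the geodesic in terms of the conjugate group. -/
lemma ThetaPt_curve (hn : 0 < n) (k : ℕ) {u x : ℝ} (hu : |u| < 1) (hx : |x| < 1) :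
    ThetaPt G k (act H.A (curve n hn u)) (act H.A (curve n hn x)) *
        ((Kr (act H.A (curve n hn u)) ^ (-(k : ℝ) / 2) : ℝ) : ℂ) *
        ((Kr (act H.A (curve n hn x)) ^ (-(k : ℝ) / 2) : ℝ) : ℂ) =
      (cB n k : ℂ) * ((∑' h : ↥(conjGrp G H), thetaTerm k (curve n hn u) h.1 (curve n hn x)) *
        ((Kr (curve n hn u) ^ (-(k : ℝ) / 2) : ℝ) : ℂ) *
        ((Kr (curve n hn x) ^ (-(k : ℝ) / 2) : ℝ) : ℂ)) := by
  have hA := H.presHerm_A hn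
  rw [H.tsum_conjGrp hn fun h => thetaTerm k (curve n hn u) h (curve n hn x),
    tsum_congr fun B : G.Γ => thetaTerm_conj k hA (DiscreteGroup.presHerm B.2)
      (curve_mem_ball hn hx) (curve_mem_ball hn hu), tsum_mul_right, H.jac_A_mul_star hn hx hu,
    ThetaPt_eq, ← hA.Kr_rpow_act k (curve_mem_ball hn hu),
    ← hA.Kr_rpow_act k (curve_mem_ball hn hx)]
  push_cast
  ring

/-- The integrand of `ThetaC`. -/
def thetaInt (hn : 0 < n) (k : ℕ) (x : ℝ) (z : Fin n → ℂ) : ℂ :=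
  ThetaPt G k (act H.A (curve n hn x)) z *
    ((Kr (act H.A (curve n hn x)) ^ (-(k : ℝ) / 2) : ℝ) : ℂ) *
    ((Kr (curve n hn x) ^ (((n : ℝ) + 1))⁻¹ : ℝ) : ℂ)

lemma abs_lt_one_of_mem {x : ℝ} (hx : x ∈ Set.Icc 0 H.T) : |x| < 1 := by
  have := H.T_lt_one
  rw [abs_lt]
  constructor <;> linarith [hx.1, hx.2]

lemma measurable_thetaInt (hn : 0 < n) (k : ℕ) :
    Measurable fun p : ℝ × (Fin n → ℂ) => H.thetaInt hn k p.1 p.2 := by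
  have hc : Measurable fun x : ℝ => curve n hn x := (continuous_curve hn).measurable
  have hW : Measurable fun x : ℝ => act H.A (curve n hn x) := (measurable_act H.A).comp hc
  have h1 : Measurable fun p : ℝ × (Fin n → ℂ) => ThetaPt G k (act H.A (curve n hn p.1)) p.2 :=
    Measurable.comp (g := fun p : (Fin n → ℂ) × (Fin n → ℂ) => ThetaPt G k p.1 p.2)
      (f := fun p : ℝ × (Fin n → ℂ) => (act H.A (curve n hn p.1), p.2))
      (measurable_ThetaPt G k) ((hW.comp measurable_fst).prodMk measurable_snd)
  have h2 : Measurable fun x : ℝ => ((Kr (act H.A (curve n hn x)) ^ (-(k : ℝ) / 2) : ℝ) : ℂ) :=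
    Complex.measurable_ofReal.comp ((measurable_Kr.comp hW).pow_const _)
  have h3 : Measurable fun x : ℝ => ((Kr (curve n hn x) ^ (((n : ℝ) + 1))⁻¹ : ℝ) : ℂ) :=
    Complex.measurable_ofReal.comp ((measurable_Kr.comp hc).pow_const _)
  exact (h1.mul (h2.comp measurable_fst)).mul (h3.comp measurable_fst)

lemma exists_norm_thetaInt_le (hn : 0 < n) {k : ℕ} (hk : 2 ≤ k) {F : Set (Fin n → ℂ)}
    (hF : IsFundDom G F) : ∃ C : ℝ, ∀ x ∈ Set.Icc 0 H.T, ∀ z ∈ ball n,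
      ‖H.thetaInt hn k x z‖ ≤ C * √(Kr z) ^ k := by
  obtain ⟨M, hM0, hM⟩ := hF.exists_tsum_jac_le hk
  have hA := H.presHerm_A hn
  have hcb : ∀ x ∈ Set.Icc 0 H.T, curve n hn x ∈ ball n :=
    fun x hx => curve_mem_ball hn (H.abs_lt_one_of_mem hx)
  have hWb : ∀ x ∈ Set.Icc 0 H.T, act H.A (curve n hn x) ∈ ball n :=
    fun x hx => hA.act_mem (hcb x hx)
  have hc : ContinuousOn (curve n hn) (Set.Icc 0 H.T) := (continuous_curve hn).continuousOn
  have hW : ContinuousOn (fun x => act H.A (curve n hn x)) (Set.Icc 0 H.T) :=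
    (differentiableOn_act hA).continuousOn.comp hc hcb
  have h1 : ContinuousOn (fun x => kerBound (act H.A (curve n hn x))) (Set.Icc 0 H.T) :=
    continuousOn_const.mul ((continuousOn_const.mul
      ((continuous_defect.comp_continuousOn hW).inv₀ fun x hx =>
        (mem_ball_iff.1 (hWb x hx)).ne')).pow (n + 1))
  have h2 : ContinuousOn (fun x => Kr (act H.A (curve n hn x)) ^ (-(k : ℝ) / 2))
      (Set.Icc 0 H.T) :=
    (Kr_continuousOn.comp hW hWb).rpow_const fun x hx => Or.inl (Kr_pos (hWb x hx)).ne'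
  have h3 : ContinuousOn (fun x => Kr (curve n hn x) ^ (((n : ℝ) + 1))⁻¹) (Set.Icc 0 H.T) :=
    (Kr_continuousOn.comp hc hcb).rpow_const fun x hx => Or.inl (Kr_pos (hcb x hx)).ne'
  obtain ⟨C, hC⟩ := isCompact_Icc.exists_bound_of_continuousOn
    (((continuousOn_const (c := (cB n k : ℝ))).mul ((h1.pow k).mul_const M)).mul h2 |>.mul h3)
  refine ⟨C, fun x hx z hz => ?_⟩
  have h4 := hF.norm_ThetaPt_le hk hM (hWb x hx) hz
  have h5 := Real.rpow_pos_of_pos (Kr_pos (hWb x hx)) (-(k : ℝ) / 2)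
  have h6 := Real.rpow_pos_of_pos (Kr_pos (hcb x hx)) ((n : ℝ) + 1)⁻¹
  rw [thetaInt, norm_mul, norm_mul, Complex.norm_of_nonneg h5.le, Complex.norm_of_nonneg h6.le]
  calc _ ≤ (cB n k * (kerBound (act H.A (curve n hn x)) ^ k * M) * √(Kr z) ^ k) *
        Kr (act H.A (curve n hn x)) ^ (-(k : ℝ) / 2) *
        Kr (curve n hn x) ^ (((n : ℝ) + 1))⁻¹ := by gcongr
    _ = (cB n k * (kerBound (act H.A (curve n hn x)) ^ k * M) *
        Kr (act H.A (curve n hn x)) ^ (-(k : ℝ) / 2) *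
        Kr (curve n hn x) ^ (((n : ℝ) + 1))⁻¹) * √(Kr z) ^ k := by ring
    _ ≤ _ := mul_le_mul_of_nonneg_right ((le_abs_self _).trans (hC x hx)) (by positivity)

lemma integral_thetaInt (hn : 0 < n) {k : ℕ} (hk : 2 ≤ k) {F : Set (Fin n → ℂ)}
    (hF : IsFundDom G F) {u x : ℝ} (hu : |u| < 1) (hx : |x| < 1) :
    ∫ z in F, H.thetaInt hn k u z * star (H.thetaInt hn k x z) * (wgt k z : ℂ) =
      (cB n k : ℂ) * ((∑' h : ↥(conjGrp G H), thetaTerm k (curve n hn u) h.1 (curve n hn x)) *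
        ((Kr (curve n hn u) ^ (-(k : ℝ) / 2) : ℝ) : ℂ) *
        ((Kr (curve n hn x) ^ (-(k : ℝ) / 2) : ℝ) : ℂ) *
        ((Kr (curve n hn u) ^ (((n : ℝ) + 1))⁻¹ : ℝ) : ℂ) *
        ((Kr (curve n hn x) ^ (((n : ℝ) + 1))⁻¹ : ℝ) : ℂ)) := by
  have hA := H.presHerm_A hn
  have hx2 : x ^ 2 < 1 := (sq_lt_one_iff_abs_lt_one x).2 hx
  have hB := presHerm_boostMat hn hx2
  have hW : act H.A (curve n hn x) = act (H.A * boostMat n hn x) 0 := by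
    rw [(hA.denom_act_mul hB zero_mem_ball).2, boostMat_act_zero hn hx2]
  have h1 := hF.integral_ThetaPt_mul_star hn hk (hA.act_mem (curve_mem_ball hn hu)) (hA.mul hB)
  rw [← hW] at h1
  have h2 := H.ThetaPt_curve hn k hu hx
  rw [← h1] at h2
  have hs : ∀ r : ℝ, star (r : ℂ) = r := Complex.conj_ofReal
  have h3 : ∀ z, H.thetaInt hn k u z * star (H.thetaInt hn k x z) * (wgt k z : ℂ) =
      ThetaPt G k (act H.A (curve n hn u)) z * star (ThetaPt G k (act H.A (curve n hn x)) z) *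
        (wgt k z : ℂ) * (((Kr (act H.A (curve n hn u)) ^ (-(k : ℝ) / 2) : ℝ) : ℂ) *
        ((Kr (act H.A (curve n hn x)) ^ (-(k : ℝ) / 2) : ℝ) : ℂ) *
        ((Kr (curve n hn u) ^ (((n : ℝ) + 1))⁻¹ : ℝ) : ℂ) *
        ((Kr (curve n hn x) ^ (((n : ℝ) + 1))⁻¹ : ℝ) : ℂ)) := fun z => by
    rw [thetaInt, thetaInt, star_mul', star_mul', hs, hs]
    ring
  simp_rw [h3]
  rw [integral_mul_const]
  linear_combination (((Kr (curve n hn u) ^ (((n : ℝ) + 1))⁻¹ : ℝ) : ℂ) *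
    ((Kr (curve n hn x) ^ (((n : ℝ) + 1))⁻¹ : ℝ) : ℂ)) * h2

end HypElt

end

end

end BallPaper

open BallPaper in
/-- (Θ_C^{(k)}, Θ_C^{(k)}) = c(𝔹ⁿ,k) ∫₀^{γ₀(0)} ∫₀^{γ₀(0)}
Σ_{h ∈ A_γ⁻¹ Γ A_γ} K(hw,ξ)^k J(h,w)^k K(ξ,ξ)^{−k/2} K(w,w)^{−k/2} φ(ξ) φ(w),
with the segment of C̃₀ from 0 to γ₀(0) parametrized by w = (0,…,0,x), ξ = (0,…,0,u),
x, u ∈ [0,T]. -/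
theorem norm_sq_decomposition (n : ℕ) (hn : 0 < n) (G : BallPaper.DiscreteGroup n)
    (H : BallPaper.HypElt n G) (F : Set (Fin n → ℂ)) (hF : IsFundDom G F)
    (k : ℕ) (hk : 2 ≤ k) :
    iprod F k (ThetaC hn H k) (ThetaC hn H k) =
      (cB n k : ℂ) * ∫ u in (0 : ℝ)..H.T, ∫ x in (0 : ℝ)..H.T,
        (∑' h : ↥(conjGrp G H),
          Kc (act (h : Matrix (Fin (n + 1)) (Fin (n + 1)) ℂ) (curve n hn x)) (curve n hn u) ^ k *
            jac (h : Matrix (Fin (n + 1)) (Fin (n + 1)) ℂ) (curve n hn x) ^ k) *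
        ((Kr (curve n hn u) ^ (-(k : ℝ) / 2) : ℝ) : ℂ) *
        ((Kr (curve n hn x) ^ (-(k : ℝ) / 2) : ℝ) : ℂ) *
        ((Kr (curve n hn u) ^ (((n : ℝ) + 1))⁻¹ : ℝ) : ℂ) *
        ((Kr (curve n hn x) ^ (((n : ℝ) + 1))⁻¹ : ℝ) : ℂ) := by

  have hT := H.T_pos.le
  have hmem : ∀ x ∈ Set.Ioc 0 H.T, |x| < 1 := fun x hx =>
    H.abs_lt_one_of_mem (Set.Ioc_subset_Icc_self hx)
  obtain ⟨C, hC⟩ := H.exists_norm_thetaInt_le hn hk hF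
  have hae : ∀ᵐ z ∂(volume.restrict F), z ∈ ball n :=
    (ae_restrict_mem hF.2.1).mono fun z hz => hF.1 hz
  have hbound : ∀ᵐ x ∂(volume.restrict (Set.Ioc 0 H.T)), ∀ᵐ z ∂(volume.restrict F),
      ‖H.thetaInt hn k x z‖ ≤ C * √(Kr z) ^ k := by
    filter_upwards [ae_restrict_mem measurableSet_Ioc] with x hx
    filter_upwards [hae] with z hz
    exact hC x (Set.Ioc_subset_Icc_self hx) z hz
  have hint : Integrable (fun z => √(Kr z) ^ k * √(Kr z) ^ k * wgt k z) (volume.restrict F) :=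
    hF.integrable_Kr.congr (hae.mono fun z hz => (sqrt_Kr_pow_mul_wgt hk hz).symm)
  have hfub := integral_integral_mul_star (H.measurable_thetaInt hn k)
    (measurable_Kr.sqrt.pow_const k) (measurable_wgt k)
    (Eventually.of_forall fun z => pow_nonneg (Real.sqrt_nonneg (Kr z)) k)
    (hae.mono fun z hz => (wgt_pos k hz).le) hbound hint
  have hlhs : iprod F k (ThetaC hn H k) (ThetaC hn H k) =
      ∫ z in F, (∫ u in Set.Ioc 0 H.T, H.thetaInt hn k u z) *
        star (∫ x in Set.Ioc 0 H.T, H.thetaInt hn k x z) * (wgt k z : ℂ) := by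
    simp only [iprod, ThetaC, intervalIntegral.integral_of_le hT]
    rfl
  rw [hlhs, hfub, ← intervalIntegral.integral_const_mul, intervalIntegral.integral_of_le hT]
  refine setIntegral_congr_fun measurableSet_Ioc fun u hu => ?_
  rw [← intervalIntegral.integral_const_mul, intervalIntegral.integral_of_le hT]
  exact setIntegral_congr_fun measurableSet_Ioc fun x hx =>
    H.integral_thetaInt hn hk hF (hmem u hu) (hmem x hx)
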